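/- Let α = v/w be a reduced rational number in (0, 1/2]. Then there exists a constant C(α) > 0 such that for all integers Q ≥ 2, | (1/#F(Q)) · Σ_{x ∈ F_α(Q)} s(x) − (1/12)(1 − 1/w²) log Q | ≤ C(α). -/

import Mathlib

open Classical in
/-- The sawtooth function `((x))`: `x - ⌊x⌋ - 1/2` for non-integral `x`, and `0` on `ℤ`. -/
noncomputable def saw (x : ℝ) : ℝ := if Int.fract x = 0 then 0 else Int.fract x - 1/2

/-- The Dedekind sum `s(a,b) = ∑_{n=1}^{b} ((n/b))·((na/b))`. -/
noncomputable def dedekindSum (a b : ℤ) : ℝ :=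
  ∑ n ∈ Finset.Icc 1 b.toNat, saw ((n : ℝ) / (b : ℝ)) * saw ((n : ℝ) * (a : ℝ) / (b : ℝ))

/-- The Dedekind sum of a rational number `x = a/b` (in lowest terms), `s(x) = s(a,b)`. -/
noncomputable def sQ (x : ℚ) : ℝ := dedekindSum x.num x.den
/-- The Farey fractions of order `Q`: rationals in `[0,1]` with denominator at most `Q`. -/
def farey (Q : ℕ) : Finset ℚ :=
  (Finset.Icc 1 Q).biUnion fun w => (Finset.Icc 0 w).image fun v : ℕ => (v : ℚ) / (w : ℚ)


namespace DSA

lemma card_mult_le (c d : ℕ) (_hd : 0 < d) (hdc : d ∣ c) :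
    ((Finset.range c).filter (fun a => d ∣ a)).card ≤ c / d := by
  have : ((Finset.range c).filter (fun a => d ∣ a)).card ≤ (Finset.range (c / d)).card := by
    apply Finset.card_le_card_of_injOn (fun a => a / d)
    · intro a ha
      simp only [Finset.coe_filter, Finset.mem_range, Set.mem_ofPred_eq] at ha
      simp only [Finset.coe_range, Set.mem_Iio]
      exact Nat.div_lt_div_of_lt_of_dvd hdc ha.1
    · intro a ha b hb hab
      simp only [Finset.coe_filter, Finset.mem_range, Set.mem_ofPred_eq] at ha hb
      exact (Nat.div_left_inj ha.2 hb.2).1 hab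
  simpa using this

lemma sum_gcd_le (c : ℕ) (hc : 0 < c) :
    ∑ a ∈ Finset.range c, Nat.gcd a c ≤ c * c.divisors.card := by
  calc ∑ a ∈ Finset.range c, Nat.gcd a c
      ≤ ∑ a ∈ Finset.range c, ∑ d ∈ c.divisors, if d ∣ a then d else 0 := by
        apply Finset.sum_le_sum
        intro a _
        have h1 : Nat.gcd a c ∈ c.divisors := by
          simp [Nat.gcd_dvd_right, hc.ne']
        have := Finset.single_le_sum (f := fun d => if d ∣ a then d else 0)
          (fun i _ => Nat.zero_le _) h1
        simpa [Nat.gcd_dvd_left] using this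
    _ = ∑ d ∈ c.divisors, ∑ a ∈ Finset.range c, if d ∣ a then d else 0 := Finset.sum_comm
    _ ≤ ∑ d ∈ c.divisors, c := by
        apply Finset.sum_le_sum
        intro d hd
        have hdc := Nat.dvd_of_mem_divisors hd
        rw [← Finset.sum_filter, Finset.sum_const, smul_eq_mul]
        calc _ ≤ c / d * d := Nat.mul_le_mul_right _ (card_mult_le c d (Nat.pos_of_mem_divisors hd) hdc)
          _ = c := Nat.div_mul_cancel hdc
    _ = c * c.divisors.card := by simp [mul_comm]

lemma sum_gcd_zmod_le (c : ℕ) [NeZero c] :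
    ∑ a : ZMod c, Nat.gcd a.val c ≤ c * c.divisors.card := by
  refine le_trans (le_of_eq ?_) (sum_gcd_le c (NeZero.pos c))
  refine Finset.sum_nbij' (fun a => a.val) (fun n => (n : ZMod c)) ?_ ?_ ?_ ?_ ?_
  · intro a _; simpa using ZMod.val_lt a
  · intro a _; simp
  · intro a _; simp
  · intro a ha; simpa using ZMod.val_cast_of_lt (Finset.mem_range.1 ha)
  · intro a _; rfl

lemma card_fiber_le (c : ℕ) [NeZero c] (y t : ZMod c) :
    (Finset.univ.filter (fun x : ZMod c => y * x = t)).card ≤ Nat.gcd y.val c := by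
  have hc := NeZero.pos c
  set g := Nat.gcd y.val c with hg
  have hgpos : 0 < g := Nat.gcd_pos_of_pos_right _ hc
  have hgc : g ∣ c := Nat.gcd_dvd_right _ _
  have h0 : (Finset.univ.filter (fun x : ZMod c => y * x = 0)).card ≤ g := by
    have hd : (c / g) ∣ c := Nat.div_dvd_of_dvd hgc
    have hpos : 0 < c / g := Nat.div_pos (Nat.le_of_dvd hc hgc) hgpos
    have key := card_mult_le c (c / g) hpos hd
    rw [Nat.div_div_self hgc hc.ne'] at key
    refine le_trans ?_ key
    apply Finset.card_le_card_of_injOn (fun x => x.val)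
    · intro x hx
      simp only [Finset.coe_filter, Finset.mem_univ, true_and, Set.mem_ofPred_eq] at hx
      simp only [Finset.coe_filter, Finset.mem_range, Set.mem_ofPred_eq]
      refine ⟨ZMod.val_lt x, ?_⟩
      have h1 : c ∣ y.val * x.val := by
        rw [← ZMod.natCast_eq_zero_iff]
        push_cast
        simpa using hx
      have h2 : (c / g) ∣ (y.val / g) * x.val := by
        have e1 : c = g * (c / g) := (Nat.mul_div_cancel' hgc).symm
        have e2 : y.val * x.val = g * ((y.val / g) * x.val) := by
          rw [← mul_assoc, Nat.mul_div_cancel' (Nat.gcd_dvd_left _ _)]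
        rw [e2] at h1
        exact Nat.dvd_of_mul_dvd_mul_left hgpos (by rw [← e1]; exact h1)
      have hcop : Nat.Coprime (c / g) (y.val / g) :=
        (Nat.coprime_div_gcd_div_gcd hgpos).symm
      exact hcop.dvd_of_dvd_mul_left h2
    · intro a _ b _ hab
      exact ZMod.val_injective c hab
  by_cases hne : (Finset.univ.filter (fun x : ZMod c => y * x = t)).Nonempty
  · obtain ⟨x0, hx0⟩ := hne
    simp only [Finset.mem_filter, Finset.mem_univ, true_and] at hx0
    refine le_trans ?_ h0
    apply Finset.card_le_card_of_injOn (fun x => x - x0)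
    · intro x hx
      simp only [Finset.coe_filter, Finset.mem_univ, true_and, Set.mem_ofPred_eq] at hx ⊢
      rw [mul_sub, hx, hx0, sub_self]
    · intro a _ b _ hab
      simpa using hab
  · rw [Finset.not_nonempty_iff_eq_empty] at hne
    rw [hne]; simp

lemma card_triple_le (c : ℕ) [NeZero c] :
    (Finset.univ.filter (fun p : ZMod c × ZMod c × ZMod c => p.1 * p.2.1 * p.2.2 = 0)).card
      ≤ c ^ 2 * c.divisors.card ^ 2 := by
  have h1 : (Finset.univ.filter (fun p : ZMod c × ZMod c × ZMod c => p.1 * p.2.1 * p.2.2 = 0)).card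
      = ∑ a : ZMod c, ∑ b : ZMod c,
        (Finset.univ.filter (fun x : ZMod c => a * b * x = 0)).card := by
    simp only [Finset.card_filter]
    rw [Fintype.sum_prod_type]
    apply Finset.sum_congr rfl; intro a _
    rw [Fintype.sum_prod_type]
  rw [h1]
  calc _ ≤ ∑ a : ZMod c, ∑ b : ZMod c, Nat.gcd a.val c * Nat.gcd b.val c := by
        apply Finset.sum_le_sum; intro a _
        apply Finset.sum_le_sum; intro b _
        refine le_trans (card_fiber_le c (a * b) 0) ?_
        have : Nat.gcd (a * b).val c = Nat.gcd (a.val * b.val) c := by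
          rw [ZMod.val_mul]; exact (Nat.mod_modEq _ _).gcd_eq
        rw [this]
        have hdvd : Nat.gcd (a.val * b.val) c ∣ Nat.gcd a.val c * Nat.gcd b.val c := by
          simpa [Nat.gcd_comm] using Nat.gcd_mul_right_dvd_mul_gcd c a.val b.val
        exact Nat.le_of_dvd (Nat.mul_pos (Nat.gcd_pos_of_pos_right _ (NeZero.pos c))
          (Nat.gcd_pos_of_pos_right _ (NeZero.pos c))) hdvd
    _ = (∑ a : ZMod c, Nat.gcd a.val c) ^ 2 := by
        rw [sq, Finset.sum_mul_sum]
    _ ≤ (c * c.divisors.card) ^ 2 := Nat.pow_le_pow_left (sum_gcd_zmod_le c) 2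
    _ = _ := by ring

/-- quadruple set -/
def quad (c : ℕ) [NeZero c] : Finset ((ZMod c)ˣ × (ZMod c)ˣ × (ZMod c)ˣ × (ZMod c)ˣ) :=
  Finset.univ.filter (fun x => (x.1 : ZMod c) + x.2.1 - x.2.2.1 - x.2.2.2 = 0 ∧
    ((x.1⁻¹ : (ZMod c)ˣ) : ZMod c) + (x.2.1⁻¹ : (ZMod c)ˣ) - (x.2.2.1⁻¹ : (ZMod c)ˣ)
      - (x.2.2.2⁻¹ : (ZMod c)ˣ) = 0)

lemma card_quad_le (c : ℕ) [NeZero c] : (quad c).card ≤ 2 * (c ^ 2 * c.divisors.card ^ 2) := by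
  classical
  let F : (ZMod c)ˣ × (ZMod c)ˣ × (ZMod c)ˣ × (ZMod c)ˣ → ZMod c × ZMod c × ZMod c :=
    fun x => ((x.1 : ZMod c) + x.2.1, (x.1 : ZMod c) - x.2.2.1, (x.2.1 : ZMod c) - x.2.2.1)
  have h1 := Finset.card_le_mul_card_image (f := F) (quad c) 2 ?_
  · refine h1.trans (Nat.mul_le_mul_left _ (le_trans (Finset.card_le_card ?_) (card_triple_le c)))
    intro p hp
    rw [Finset.mem_image] at hp
    obtain ⟨⟨x1, x2, x3, x4⟩, hx, rfl⟩ := hp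
    simp only [quad, Finset.mem_filter, Finset.mem_univ, true_and] at hx ⊢
    obtain ⟨hs, ht⟩ := hx
    have i1 : (x1 : ZMod c) * (x1⁻¹ : (ZMod c)ˣ) = 1 := by simp
    have i2 : (x2 : ZMod c) * (x2⁻¹ : (ZMod c)ˣ) = 1 := by simp
    have i3 : (x3 : ZMod c) * (x3⁻¹ : (ZMod c)ˣ) = 1 := by simp
    have i4 : (x4 : ZMod c) * (x4⁻¹ : (ZMod c)ˣ) = 1 := by simp
    simp only [F]
    clear h1 F
    generalize (x1 : ZMod c) = a1 at *
    generalize (x2 : ZMod c) = a2 at *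
    generalize (x3 : ZMod c) = a3 at *
    generalize (x4 : ZMod c) = a4 at *
    generalize ((x1⁻¹ : (ZMod c)ˣ) : ZMod c) = b1 at *
    generalize ((x2⁻¹ : (ZMod c)ˣ) : ZMod c) = b2 at *
    generalize ((x3⁻¹ : (ZMod c)ˣ) : ZMod c) = b3 at *
    generalize ((x4⁻¹ : (ZMod c)ˣ) : ZMod c) = b4 at *
    have h4 : a4 = a1 + a2 - a3 := by linear_combination -hs
    -- (a1+a2) a3 a4 = (a3+a4) a1 a2
    have key : (a1 + a2) * (a3 * a4) - (a3 + a4) * (a1 * a2) = 0 := by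
      have e : a1 * a2 * a3 * a4 * (b1 + b2 - b3 - b4) = 0 := by rw [ht, mul_zero]
      have e' : a1 * a2 * a3 * a4 * (b1 + b2 - b3 - b4) =
        (a1 * b1) * (a2 * a3 * a4) + (a2 * b2) * (a1 * a3 * a4) - (a3 * b3) * (a1 * a2 * a4)
          - (a4 * b4) * (a1 * a2 * a3) := by ring
      rw [e', i1, i2, i3, i4] at e
      linear_combination e
    rw [h4] at key
    linear_combination -key
  · intro b _
    -- fibres inject into solutions of 2*x3 = const
    have hle : ({a ∈ quad c | F a = b}).card ≤
        (Finset.univ.filter (fun x : ZMod c => (2 : ZMod c) * x = b.1 - b.2.1 - b.2.2)).card := by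
      apply Finset.card_le_card_of_injOn (fun x => ((x.2.2.1 : (ZMod c)ˣ) : ZMod c))
      · rintro ⟨x1, x2, x3, x4⟩ hx
        simp only [Finset.coe_filter, Set.mem_ofPred_eq, F] at hx
        simp only [Finset.coe_filter, Finset.mem_univ, true_and, Set.mem_ofPred_eq]
        rw [← hx.2]; ring
      · rintro ⟨x1, x2, x3, x4⟩ hx ⟨y1, y2, y3, y4⟩ hy h3
        simp only [Finset.coe_filter, Set.mem_ofPred_eq, F, quad, Finset.mem_filter,
          Finset.mem_univ, true_and] at hx hy
        simp only at h3
        have hxy := hx.2.trans hy.2.symm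
        simp only [Prod.mk.injEq] at hxy
        have e1 : (x1 : ZMod c) = y1 := by linear_combination hxy.2.1 + h3
        have e2 : (x2 : ZMod c) = y2 := by linear_combination hxy.2.2 + h3
        have e4 : (x4 : ZMod c) = y4 := by
          linear_combination hy.1.1 - hx.1.1 + e1 + e2 - h3
        simp only [Prod.mk.injEq]
        exact ⟨Units.ext e1, Units.ext e2, Units.ext h3, Units.ext e4⟩
    refine hle.trans ((card_fiber_le c 2 _).trans ?_)
    by_cases h2 : (2 : ZMod c).val = 0
    · have : c ∣ 2 := by
        rw [← ZMod.natCast_eq_zero_iff]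
        exact (ZMod.val_eq_zero _).1 (by simpa using h2)
      rw [h2, Nat.gcd_zero_left]; exact Nat.le_of_dvd (by norm_num) this
    · refine (Nat.gcd_le_left _ (Nat.pos_of_ne_zero h2)).trans ?_
      have : (2 : ZMod c) = ((2 : ℕ) : ZMod c) := by norm_num
      rw [this, ZMod.val_natCast]; exact Nat.mod_le _ _

end DSA


namespace DSA

/-- Kloosterman sum -/
noncomputable def kl (c : ℕ) [NeZero c] (m n : ZMod c) : ℂ :=
  ∑ x : (ZMod c)ˣ, ZMod.stdAddChar (m * (x : ZMod c) + n * ((x⁻¹ : (ZMod c)ˣ) : ZMod c))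

lemma kl_pow4 (c : ℕ) [NeZero c] (m n : ZMod c) :
    ((‖kl c m n‖ ^ 4 : ℝ) : ℂ) = ∑ x : (ZMod c)ˣ × (ZMod c)ˣ × (ZMod c)ˣ × (ZMod c)ˣ,
      ZMod.stdAddChar (m * ((x.1 : ZMod c) + (x.2.1 : ZMod c) - (x.2.2.1 : ZMod c) - (x.2.2.2 : ZMod c))) *
      ZMod.stdAddChar (n * (((x.1⁻¹ : (ZMod c)ˣ) : ZMod c) + ((x.2.1⁻¹ : (ZMod c)ˣ) : ZMod c)
        - ((x.2.2.1⁻¹ : (ZMod c)ˣ) : ZMod c) - ((x.2.2.2⁻¹ : (ZMod c)ˣ) : ZMod c))) := by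
  have h1 : ((‖kl c m n‖ ^ 4 : ℝ) : ℂ) = (kl c m n * kl c m n) *
      ((starRingEnd ℂ) (kl c m n) * (starRingEnd ℂ) (kl c m n)) := by
    have : kl c m n * (starRingEnd ℂ) (kl c m n) = ((‖kl c m n‖ ^ 2 : ℝ) : ℂ) := by
      rw [Complex.mul_conj, Complex.normSq_eq_norm_sq]
    calc ((‖kl c m n‖ ^ 4 : ℝ) : ℂ) = ((‖kl c m n‖ ^ 2 : ℝ) : ℂ) * ((‖kl c m n‖ ^ 2 : ℝ) : ℂ) := by
          push_cast; ring
      _ = _ := by rw [← this]; ring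
  have h2 : (starRingEnd ℂ) (kl c m n) = ∑ x : (ZMod c)ˣ,
      ZMod.stdAddChar (-(m * (x : ZMod c) + n * ((x⁻¹ : (ZMod c)ˣ) : ZMod c))) := by
    unfold kl
    rw [map_sum]
    apply Finset.sum_congr rfl; intro x _
    rw [AddChar.map_neg_eq_conj]
  rw [h1, h2]
  unfold kl
  simp only [Fintype.sum_prod_type]
  rw [mul_assoc, Finset.sum_mul]
  apply Finset.sum_congr rfl; intro x1 _
  rw [Finset.sum_mul, Finset.mul_sum]
  apply Finset.sum_congr rfl; intro x2 _
  rw [Finset.sum_mul, Finset.mul_sum, Finset.mul_sum]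
  apply Finset.sum_congr rfl; intro x3 _
  rw [Finset.mul_sum, Finset.mul_sum, Finset.mul_sum]
  apply Finset.sum_congr rfl; intro x4 _
  rw [← AddChar.map_add_eq_mul, ← AddChar.map_add_eq_mul, ← AddChar.map_add_eq_mul,
    ← AddChar.map_add_eq_mul]
  congr 1; ring

lemma kl_moment (c : ℕ) [NeZero c] :
    ∑ m : ZMod c, ∑ n : ZMod c, ‖kl c m n‖ ^ 4 = (c : ℝ) ^ 2 * (quad c).card := by
  have : ((∑ m : ZMod c, ∑ n : ZMod c, ‖kl c m n‖ ^ 4 : ℝ) : ℂ) = (((c : ℝ) ^ 2 * (quad c).card : ℝ) : ℂ) := by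
    rw [Complex.ofReal_sum]
    simp_rw [Complex.ofReal_sum, kl_pow4]
    rw [Finset.sum_congr rfl (fun m _ => Finset.sum_comm)]
    rw [Finset.sum_comm]
    simp_rw [← Finset.mul_sum, ← Finset.sum_mul]
    simp_rw [AddChar.sum_mulShift _ (ZMod.isPrimitive_stdAddChar c)]
    rw [quad, Finset.card_filter]
    push_cast
    rw [Finset.mul_sum]
    apply Finset.sum_congr rfl
    intro x _
    simp only [ZMod.card]
    by_cases h1 : (x.1 : ZMod c) + x.2.1 - x.2.2.1 - x.2.2.2 = 0
    · by_cases h2 : ((x.1⁻¹ : (ZMod c)ˣ) : ZMod c) + (x.2.1⁻¹ : (ZMod c)ˣ) - (x.2.2.1⁻¹ : (ZMod c)ˣ)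
        - (x.2.2.2⁻¹ : (ZMod c)ˣ) = 0
      · rw [if_pos h1, if_pos h2, if_pos ⟨h1, h2⟩]; push_cast; ring
      · simp [h2]
    · simp [h1]
  exact_mod_cast this

lemma kl_shift (c : ℕ) [NeZero c] (m n : ZMod c) (a : (ZMod c)ˣ) :
    kl c (m * a) (n * ((a⁻¹ : (ZMod c)ˣ) : ZMod c)) = kl c m n := by
  unfold kl
  rw [← Equiv.sum_comp (Equiv.mulLeft a)
    (fun x : (ZMod c)ˣ => ZMod.stdAddChar (m * (x : ZMod c) + n * ((x⁻¹ : (ZMod c)ˣ) : ZMod c)))]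
  apply Finset.sum_congr rfl; intro x _
  congr 1
  simp only [Equiv.coe_mulLeft, mul_inv_rev, Units.val_mul]
  ring

lemma kl_orbit (c : ℕ) [NeZero c] (m n : ZMod c) :
    (Nat.totient c : ℝ) * ‖kl c m n‖ ^ 4 ≤ (Nat.gcd n.val c : ℝ) * ((c : ℝ) ^ 2 * (quad c).card) := by
  classical
  have e1 : (Nat.totient c : ℝ) * ‖kl c m n‖ ^ 4 = ∑ a : (ZMod c)ˣ,
      ‖kl c (m * a) (n * ((a⁻¹ : (ZMod c)ˣ) : ZMod c))‖ ^ 4 := by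
    simp_rw [kl_shift]
    rw [Finset.sum_const, Finset.card_univ, ZMod.card_units_eq_totient]
    simp
  rw [e1, ← kl_moment, ← Fintype.sum_prod_type']
  let F : (ZMod c)ˣ → ZMod c × ZMod c := fun a => (m * a, n * ((a⁻¹ : (ZMod c)ˣ) : ZMod c))
  have e2 := (Finset.sum_fiberwise_of_maps_to (s := Finset.univ) (t := Finset.univ) (g := F)
    (fun i _ => Finset.mem_univ _)
    (fun a : (ZMod c)ˣ => ‖kl c (m * a) (n * ((a⁻¹ : (ZMod c)ˣ) : ZMod c))‖ ^ 4)).symm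
  rw [e2, Finset.mul_sum]
  apply Finset.sum_le_sum
  rintro ⟨p, q⟩ _
  have e3 : ∑ i ∈ Finset.univ.filter (fun i => F i = (p, q)),
      ‖kl c (m * i) (n * ((i⁻¹ : (ZMod c)ˣ) : ZMod c))‖ ^ 4 =
      ((Finset.univ.filter (fun i => F i = (p, q))).card : ℝ) * ‖kl c p q‖ ^ 4 := by
    rw [Finset.sum_congr rfl (g := fun _ => ‖kl c p q‖ ^ 4), Finset.sum_const, nsmul_eq_mul]
    intro i hi
    simp only [Finset.mem_filter, Finset.mem_univ, true_and, F, Prod.mk.injEq] at hi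
    rw [hi.1, hi.2]
  rw [e3]
  apply mul_le_mul_of_nonneg_right _ (by positivity)
  norm_cast
  refine le_trans ?_ (card_fiber_le c n q)
  apply Finset.card_le_card_of_injOn (fun a => ((a⁻¹ : (ZMod c)ˣ) : ZMod c))
  · intro a ha
    simp only [Finset.coe_filter, Finset.mem_univ, true_and, Set.mem_ofPred_eq, F, Prod.mk.injEq] at ha ⊢
    exact ha.2
  · intro a _ b _ hab
    exact inv_injective (Units.ext hab)

lemma le_totient_mul (c : ℕ) (hc : 0 < c) : c ≤ Nat.totient c * c.divisors.card := by
  calc c = ∑ d ∈ c.divisors, Nat.totient d := (Nat.sum_totient c).symm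
    _ ≤ ∑ d ∈ c.divisors, Nat.totient c := Finset.sum_le_sum (fun d hd =>
        Nat.le_of_dvd (Nat.totient_pos.2 hc) (Nat.totient_dvd_of_dvd (Nat.dvd_of_mem_divisors hd)))
    _ = _ := by simp [mul_comm]

lemma kl_bound (c : ℕ) [NeZero c] (m n : ZMod c) :
    ‖kl c m n‖ ≤ (Nat.gcd n.val c : ℝ) * (2 * (c : ℝ) ^ 3 * (c.divisors.card : ℝ) ^ 3) ^ (1/4 : ℝ) := by
  have hc := NeZero.pos c
  set g : ℝ := (Nat.gcd n.val c : ℝ) with hg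
  have hg1 : 1 ≤ g := by
    rw [hg]; exact_mod_cast Nat.gcd_pos_of_pos_right _ hc
  set t : ℝ := (c.divisors.card : ℝ) with ht
  have hcR : (0 : ℝ) < c := by exact_mod_cast hc
  have h1 := kl_orbit c m n
  have h2 : ((quad c).card : ℝ) ≤ 2 * ((c : ℝ) ^ 2 * t ^ 2) := by
    rw [ht]; exact_mod_cast card_quad_le c
  have h3 : (c : ℝ) ≤ (Nat.totient c : ℝ) * t := by
    rw [ht]; exact_mod_cast le_totient_mul c hc
  have ht0 : 0 ≤ t := by positivity
  have h4 : ‖kl c m n‖ ^ 4 ≤ g * (2 * (c : ℝ) ^ 3 * t ^ 3) := by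
    have hx : 0 ≤ ‖kl c m n‖ ^ 4 := by positivity
    have : (c : ℝ) * ‖kl c m n‖ ^ 4 ≤ c * (g * (2 * (c : ℝ) ^ 3 * t ^ 3)) := by
      calc (c : ℝ) * ‖kl c m n‖ ^ 4 ≤ ((Nat.totient c : ℝ) * t) * ‖kl c m n‖ ^ 4 :=
            mul_le_mul_of_nonneg_right h3 hx
        _ = t * ((Nat.totient c : ℝ) * ‖kl c m n‖ ^ 4) := by ring
        _ ≤ t * (g * ((c : ℝ) ^ 2 * (quad c).card)) := mul_le_mul_of_nonneg_left h1 ht0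
        _ ≤ t * (g * ((c : ℝ) ^ 2 * (2 * ((c : ℝ) ^ 2 * t ^ 2)))) := by gcongr
        _ = _ := by ring
    exact le_of_mul_le_mul_left this hcR
  have hK : 0 ≤ 2 * (c : ℝ) ^ 3 * t ^ 3 := by positivity
  have h5 : ‖kl c m n‖ ^ 4 ≤ (g * (2 * (c : ℝ) ^ 3 * t ^ 3) ^ (1/4 : ℝ)) ^ 4 := by
    rw [mul_pow, ← Real.rpow_natCast (_ ^ (1/4 : ℝ)) 4, ← Real.rpow_mul hK]
    norm_num
    refine h4.trans ?_
    apply mul_le_mul_of_nonneg_right _ hK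
    calc g = g ^ 1 := (pow_one g).symm
      _ ≤ g ^ 4 := pow_le_pow_right₀ hg1 (by norm_num)
  exact le_of_pow_le_pow_left₀ (by norm_num) (by positivity) h5

end DSA


namespace DSA

lemma divisor_bound (ε : ℝ) (hε : 0 < ε) : ∃ C : ℝ, 0 < C ∧ ∀ n : ℕ, n ≠ 0 →
    (n.divisors.card : ℝ) ≤ C * (n : ℝ) ^ ε := by
  set δ : ℝ := (2:ℝ) ^ ε - 1 with hδ
  have hδ0 : 0 < δ := by
    have : (1:ℝ) < (2:ℝ) ^ ε := Real.one_lt_rpow (by norm_num) hε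
    linarith
  set K : ℝ := 1 + 1 / δ with hK
  have hK1 : 1 ≤ K := by have : 0 < 1/δ := by positivity
                         linarith
  set P : ℕ := ⌈(2:ℝ) ^ (1/ε)⌉₊ with hP
  refine ⟨K ^ P, by positivity, ?_⟩
  intro n hn
  have h1 : (n : ℝ) ^ ε = ∏ p ∈ n.primeFactors, ((p:ℝ) ^ ε) ^ (n.factorization p) := by
    conv_lhs => rw [← Nat.prod_factorization_pow_eq_self hn]
    rw [Finsupp.prod, Nat.support_factorization, Nat.cast_prod,
      ← Real.finsetProd_rpow _ _ (fun i _ => by positivity)]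
    apply Finset.prod_congr rfl
    intro p _
    push_cast
    rw [← Real.rpow_natCast, ← Real.rpow_mul (by positivity), ← Real.rpow_natCast,
      ← Real.rpow_mul (by positivity), mul_comm]
  have h2 : ∀ p ∈ n.primeFactors, (((n.factorization p + 1 : ℕ)) : ℝ) ≤
      (if p < P then K else 1) * ((p:ℝ) ^ ε) ^ (n.factorization p) := by
    intro p hp
    have hp2 : 2 ≤ p := (Nat.prime_of_mem_primeFactors hp).two_le
    set k := n.factorization p
    split_ifs with h
    · have : (1 + (k:ℝ) * δ) ≤ ((p:ℝ)^ε)^k := by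
        have e1 : (1:ℝ) + k * δ ≤ (1 + δ) ^ k := one_add_mul_le_pow (by linarith) k
        have e2 : (1 + δ) ^ k ≤ ((p:ℝ)^ε)^k := by
          apply pow_le_pow_left₀ (by linarith)
          have : (2:ℝ)^ε ≤ (p:ℝ)^ε := Real.rpow_le_rpow (by norm_num) (by exact_mod_cast hp2) hε.le
          linarith
        linarith
      have e3 : ((k + 1 : ℕ):ℝ) ≤ K * (1 + (k:ℝ) * δ) := by
        have : K * (1 + (k:ℝ) * δ) = 1 + 1/δ + k * δ + k := by
          rw [hK]; field_simp; ring
        rw [this]; push_cast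
        have : 0 < 1/δ := by positivity
        have : 0 ≤ k * δ := by positivity
        linarith
      exact e3.trans (mul_le_mul_of_nonneg_left this (by linarith))
    · rw [one_mul]
      push Not at h
      have hh : (2:ℝ) ≤ (p:ℝ)^ε := by
        have : (2:ℝ) ^ (1/ε) ≤ p := Nat.ceil_le.mp h
        have := Real.rpow_le_rpow (by positivity) this hε.le
        rwa [← Real.rpow_mul (by norm_num), one_div_mul_cancel hε.ne', Real.rpow_one] at this
      have e1 : ((k+1:ℕ):ℝ) ≤ (2:ℝ)^k := by exact_mod_cast Nat.lt_two_pow_self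
      exact e1.trans (pow_le_pow_left₀ (by norm_num) hh k)
  rw [Nat.card_divisors hn, Nat.cast_prod, h1]
  calc _ ≤ ∏ p ∈ n.primeFactors, ((if p < P then K else 1) * ((p:ℝ) ^ ε) ^ (n.factorization p)) :=
        Finset.prod_le_prod (fun i _ => by positivity) h2
    _ = (∏ p ∈ n.primeFactors, (if p < P then K else 1)) *
        ∏ p ∈ n.primeFactors, ((p:ℝ) ^ ε) ^ (n.factorization p) := Finset.prod_mul_distrib
    _ ≤ _ := by
      apply mul_le_mul_of_nonneg_right _ (by positivity)
      rw [← Finset.prod_filter, Finset.prod_const]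
      apply pow_le_pow_right₀ hK1
      calc _ ≤ (Finset.range P).card := Finset.card_le_card (fun p hp => by
            simp only [Finset.mem_filter] at hp; simp [hp.2])
        _ = P := by simp

lemma sum_gcd_div_le (c : ℕ) (hc : 0 < c) :
    ∑ a ∈ Finset.Icc 1 (c-1), (Nat.gcd a c : ℝ) / a ≤ c.divisors.card * (1 + Real.log c) := by
  have h1 : ∀ a ∈ Finset.Icc 1 (c-1), (Nat.gcd a c : ℝ) / a ≤
      ∑ d ∈ c.divisors, if d ∣ a then (d:ℝ)/a else 0 := by
    intro a ha
    have hm : Nat.gcd a c ∈ c.divisors := by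
      simp [Nat.mem_divisors, Nat.gcd_dvd_right, hc.ne']
    have := Finset.single_le_sum (f := fun d => if d ∣ a then (d:ℝ)/a else 0)
      (fun d _ => by split_ifs <;> positivity) hm
    simpa [Nat.gcd_dvd_left] using this
  calc _ ≤ ∑ a ∈ Finset.Icc 1 (c-1), ∑ d ∈ c.divisors, (if d ∣ a then (d:ℝ)/a else 0) :=
        Finset.sum_le_sum h1
    _ = ∑ d ∈ c.divisors, ∑ a ∈ Finset.Icc 1 (c-1), (if d ∣ a then (d:ℝ)/a else 0) := Finset.sum_comm
    _ ≤ ∑ d ∈ c.divisors, (1 + Real.log c) := by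
        apply Finset.sum_le_sum
        intro d hd
        have hd0 : 0 < d := Nat.pos_of_mem_divisors hd
        rw [← Finset.sum_filter]
        calc _ ≤ ∑ a ∈ (Finset.range c).image (fun i => d * (i+1)), (d:ℝ)/a := by
              apply Finset.sum_le_sum_of_subset_of_nonneg
              · intro a ha
                simp only [Finset.mem_filter, Finset.mem_Icc] at ha
                obtain ⟨⟨h1, h2⟩, k, rfl⟩ := ha
                have hk : 0 < k := by
                  rcases Nat.eq_zero_or_pos k with h | h
                  · subst h; simp at h1
                  · exact h
                simp only [Finset.mem_image, Finset.mem_range]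
                have : k ≤ d * k := Nat.le_mul_of_pos_left k hd0
                exact ⟨k-1, by omega, by congr 1; omega⟩
              · intros; positivity
          _ = ∑ i ∈ Finset.range c, (d:ℝ)/((d * (i+1) : ℕ):ℝ) := by
              apply Finset.sum_image
              intro x _ y _ h
              have := Nat.eq_of_mul_eq_mul_left hd0 h
              omega
          _ = ((harmonic c : ℚ) : ℝ) := by
              unfold harmonic
              push_cast
              apply Finset.sum_congr rfl
              intro i _
              have : (d:ℝ) ≠ 0 := by positivity
              field_simp
          _ ≤ _ := harmonic_le_one_add_log c
    _ = _ := by simp; ring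

end DSA


namespace DSA

noncomputable def hh (c : ℕ) (a : ZMod c) : ℝ := (c:ℝ)/2 * (1/(a.val:ℝ) + 1/((c:ℝ) - a.val))

lemma hh_nonneg (c : ℕ) [NeZero c] (a : ZMod c) : 0 ≤ hh c a := by
  unfold hh
  have : (a.val:ℝ) ≤ c := by exact_mod_cast (ZMod.val_lt a).le
  have : 0 ≤ (c:ℝ) - a.val := by linarith
  positivity

lemma hh_neg (c : ℕ) [NeZero c] (a : ZMod c) : hh c (-a) = hh c a := by
  unfold hh
  rw [ZMod.neg_val]
  split_ifs with h
  · simp [h]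
  · rw [Nat.cast_sub (ZMod.val_lt a).le]
    congr 1
    rw [add_comm]; congr 2; ring

lemma norm_sub_one (c : ℕ) [NeZero c] (a : ZMod c) (ha : a ≠ 0) :
    2 / ‖(ZMod.stdAddChar a : ℂ) - 1‖ ≤ hh c a := by
  have hc : (0:ℝ) < c := by exact_mod_cast Nat.pos_of_ne_zero (NeZero.ne c)
  have hv0 : (0:ℝ) < a.val := by
    have : a.val ≠ 0 := by rwa [Ne, ZMod.val_eq_zero]
    exact_mod_cast Nat.pos_of_ne_zero this
  have hvc : (a.val:ℝ) < c := by exact_mod_cast ZMod.val_lt a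
  have e1 : (ZMod.stdAddChar a : ℂ) = Complex.exp (Complex.I * ((2 * Real.pi * a.val / c : ℝ) : ℂ)) := by
    conv_lhs => rw [← ZMod.natCast_zmod_val a]
    have := ZMod.stdAddChar_coe (N := c) (a.val : ℤ)
    rw [Int.cast_natCast] at this
    rw [this]
    push_cast
    congr 1; ring
  rw [e1, Complex.norm_exp_I_mul_ofReal_sub_one]
  set t := (a.val:ℝ) with ht
  have e2 : 2 * Real.pi * t / c / 2 = Real.pi * t / c := by ring
  rw [e2]
  have hd : 0 < (c:ℝ) - t := by linarith
  have key : ∀ s : ℝ, 0 < s → s ≤ c / 2 → 2 * s / c ≤ Real.sin (Real.pi * s / c) := by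
    intro s hs1 hs2
    have h := Real.mul_le_sin (x := Real.pi * s / c) (by positivity) (by
      rw [div_le_div_iff₀ hc (by norm_num)]
      nlinarith [Real.pi_pos])
    calc _ = 2 / Real.pi * (Real.pi * s / c) := by field_simp
      _ ≤ _ := h
  have hfin : ∀ s : ℝ, 0 < s → 2 * s / c ≤ Real.sin (Real.pi * t / c) →
      2 / ‖2 * Real.sin (Real.pi * t / c)‖ ≤ c / 2 * (1 / s) := by
    intro s hs h
    have hp : 0 < 2 * s / c := by positivity
    rw [Real.norm_of_nonneg (by linarith)]
    rw [div_le_iff₀ (by linarith)]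
    calc (2:ℝ) = c / 2 * (1/s) * (2 * (2 * s / c)) := by field_simp
      _ ≤ _ := by gcongr
  unfold hh
  rcases le_total t (c/2) with h | h
  · have := hfin t hv0 (key t hv0 h)
    refine this.trans ?_
    rw [← ht]
    have : 0 < 1 / ((c:ℝ) - t) := by positivity
    nlinarith
  · have hs := key (c - t) hd (by linarith)
    have e3 : Real.pi * (c - t) / c = Real.pi - Real.pi * t / c := by field_simp
    rw [e3, Real.sin_pi_sub] at hs
    refine (hfin (c-t) hd hs).trans ?_
    rw [← ht]
    have : 0 < 1 / t := by positivity
    nlinarith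

lemma geom_bound (c : ℕ) [NeZero c] (a : ZMod c) (ha : a ≠ 0) (V1 V2 : ℕ) :
    ‖∑ v ∈ Finset.Ioc V1 V2, (ZMod.stdAddChar (a * (v : ZMod c)) : ℂ)‖ ≤ hh c a := by
  rcases le_total V2 V1 with h | h
  · rw [Finset.Ioc_eq_empty (by omega)]; simpa using hh_nonneg c a
  set z : ℂ := ZMod.stdAddChar a with hz
  have e1 : ∑ v ∈ Finset.Ioc V1 V2, (ZMod.stdAddChar (a * (v : ZMod c)) : ℂ) =
      ∑ v ∈ Finset.Ico (V1+1) (V2+1), z ^ v := by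
    have : Finset.Ioc V1 V2 = Finset.Ico (V1+1) (V2+1) := by ext; simp
    rw [this]
    apply Finset.sum_congr rfl
    intro v _
    rw [hz, ← AddChar.map_nsmul_eq_pow, nsmul_eq_mul, mul_comm]
  rw [e1]
  have hz1 : z ≠ 1 := by
    intro h
    apply ha
    have : (ZMod.stdAddChar a : ℂ) = ZMod.stdAddChar (0 : ZMod c) := by rw [← hz, h]; simp
    exact ZMod.injective_stdAddChar this
  have hn : ‖z‖ = 1 := by rw [hz]; simp
  refine le_trans ?_ (norm_sub_one c a ha)
  rw [geom_sum_Ico hz1 (by omega), norm_div]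
  apply div_le_div_of_nonneg_right _ (norm_nonneg _)
  refine (norm_sub_le _ _).trans ?_
  rw [norm_pow, norm_pow, hn]; norm_num

lemma sum_zmod_ne_zero (c : ℕ) [NeZero c] (f : ℕ → ℝ) :
    ∑ a : ZMod c, (if a = 0 then 0 else f a.val) = ∑ a ∈ Finset.Icc 1 (c-1), f a := by
  have hc := Nat.pos_of_ne_zero (NeZero.ne c)
  have e0 : ∑ a : ZMod c, (if a = 0 then 0 else f a.val) =
      ∑ a : ZMod c, (if ¬ a = 0 then f a.val else 0) := by simp only [ite_not]
  rw [e0, ← Finset.sum_filter]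
  apply Finset.sum_bij (fun (a : ZMod c) _ => a.val)
  · intro a ha
    simp only [Finset.mem_filter, Finset.mem_univ, true_and] at ha
    have : a.val ≠ 0 := by rwa [Ne, ZMod.val_eq_zero]
    have := ZMod.val_lt a
    simp; omega
  · intro a _ b _ h
    exact ZMod.val_injective c h
  · intro b hb
    simp at hb
    have hbc : b < c := by omega
    refine ⟨(b : ZMod c), ?_, ZMod.val_cast_of_lt hbc⟩
    simp only [Finset.mem_filter, Finset.mem_univ, true_and]
    rw [← ZMod.val_eq_zero, ZMod.val_cast_of_lt hbc]; omega
  · intros; rfl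

lemma sum_hh_gcd (c : ℕ) [NeZero c] :
    ∑ a : ZMod c, (if a = 0 then 0 else hh c a * (Nat.gcd a.val c : ℝ)) ≤
      c * (c.divisors.card * (1 + Real.log c)) := by
  have hc := Nat.pos_of_ne_zero (NeZero.ne c)
  have := sum_zmod_ne_zero c (fun a => (c:ℝ)/2 * (1/(a:ℝ) + 1/((c:ℝ) - a)) * (Nat.gcd a c : ℝ))
  unfold hh
  rw [this]
  have e1 : ∑ a ∈ Finset.Icc 1 (c-1), (c:ℝ)/2 * (1/(a:ℝ) + 1/((c:ℝ) - a)) * (Nat.gcd a c : ℝ)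
     = c/2 * ∑ a ∈ Finset.Icc 1 (c-1), (Nat.gcd a c : ℝ) / a +
       c/2 * ∑ a ∈ Finset.Icc 1 (c-1), (Nat.gcd a c : ℝ) / ((c:ℝ) - a) := by
    rw [Finset.mul_sum, Finset.mul_sum, ← Finset.sum_add_distrib]
    apply Finset.sum_congr rfl
    intros; ring
  have e2 : ∑ a ∈ Finset.Icc 1 (c-1), (Nat.gcd a c : ℝ) / ((c:ℝ) - a) =
      ∑ a ∈ Finset.Icc 1 (c-1), (Nat.gcd a c : ℝ) / a := by
    apply Finset.sum_nbij' (fun a => c - a) (fun a => c - a)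
    · intro a ha; simp at ha ⊢; omega
    · intro a ha; simp at ha ⊢; omega
    · intro a ha; simp at ha ⊢; omega
    · intro a ha; simp at ha ⊢; omega
    · intro a ha
      simp at ha
      have h : a ≤ c := by omega
      rw [Nat.cast_sub h]
      congr 2
      rw [Nat.gcd_comm, Nat.gcd_comm (c-a), Nat.gcd_self_sub_right h]
  rw [e1, e2]
  have := sum_gcd_div_le c hc
  have hc' : (0:ℝ) ≤ c := by positivity
  nlinarith [mul_le_mul_of_nonneg_left this hc']

end DSA


namespace DSA

noncomputable def OO (c : ℕ) (L : ℕ) (x : ZMod c) : ℝ :=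
  ∑ l ∈ Finset.Icc 1 L, ((if x = -(l : ZMod c) then 1 else 0) - (if x = (l : ZMod c) then 1 else 0))

noncomputable def DD (c : ℕ) [NeZero c] (L : ℕ) (y : ZMod c) : ℝ :=
  ∑ x : (ZMod c)ˣ, if y = ((x⁻¹ : (ZMod c)ˣ) : ZMod c) then OO c L x else 0

noncomputable def AA (c : ℕ) [NeZero c] (V1 V2 : ℕ) (m : ZMod c) : ℂ :=
  ∑ v ∈ Finset.Ioc V1 V2, ZMod.stdAddChar (-m * (v : ZMod c))

noncomputable def BB (c : ℕ) [NeZero c] (L : ℕ) (n : ZMod c) : ℂ :=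
  ∑ l ∈ Finset.Icc 1 L, (ZMod.stdAddChar (n * (l : ZMod c)) - ZMod.stdAddChar (-n * (l : ZMod c)))

lemma orth (c : ℕ) [NeZero c] (a b : ZMod c) :
    ∑ m : ZMod c, (ZMod.stdAddChar (m * (a - b)) : ℂ) = if a = b then (c:ℂ) else 0 := by
  have := AddChar.sum_mulShift (a - b) (ZMod.isPrimitive_stdAddChar c)
  rw [this]
  simp [sub_eq_zero, ZMod.card]

lemma OO_fourier (c : ℕ) [NeZero c] (L : ℕ) (x : ZMod c) :
    (c:ℂ) * (OO c L x : ℂ) = ∑ n : ZMod c, BB c L n * ZMod.stdAddChar (n * x) := by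
  unfold OO BB
  push_cast
  simp_rw [Finset.sum_mul]
  rw [Finset.sum_comm, Finset.mul_sum]
  apply Finset.sum_congr rfl
  intro l _
  have e1 := orth c x (-(l:ZMod c))
  have e2 := orth c x (l:ZMod c)
  simp_rw [sub_mul, ← AddChar.map_add_eq_mul, Finset.sum_sub_distrib]
  have f1 : ∀ n : ZMod c, n * (l:ZMod c) + n * x = n * (x - -(l:ZMod c)) := fun n => by ring
  have f2 : ∀ n : ZMod c, -n * (l:ZMod c) + n * x = n * (x - (l:ZMod c)) := fun n => by ring
  simp_rw [f1, f2, e1, e2]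
  split_ifs <;> simp

lemma DD_fourier (c : ℕ) [NeZero c] (L V1 V2 : ℕ) :
    (c:ℂ)^2 * ((∑ v ∈ Finset.Ioc V1 V2, DD c L v : ℝ) : ℂ) =
      ∑ m : ZMod c, ∑ n : ZMod c, AA c V1 V2 m * BB c L n * kl c n m := by
  have e1 : ∀ v : ℕ, (c:ℂ)^2 * (DD c L v : ℂ) = ∑ x : (ZMod c)ˣ, ∑ m : ZMod c, ∑ n : ZMod c,
      ZMod.stdAddChar (-m * (v:ZMod c)) * BB c L n *
        ZMod.stdAddChar (n * (x : ZMod c) + m * ((x⁻¹ : (ZMod c)ˣ) : ZMod c)) := by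
    intro v
    unfold DD
    push_cast
    rw [Finset.mul_sum]
    apply Finset.sum_congr rfl
    intro x _
    have o := orth c ((x⁻¹ : (ZMod c)ˣ) : ZMod c) (v : ZMod c)
    have : (c:ℂ)^2 * ((if (v:ZMod c) = ((x⁻¹ : (ZMod c)ˣ) : ZMod c) then OO c L x else 0 : ℝ) : ℂ) =
        (∑ m : ZMod c, (ZMod.stdAddChar (m * (((x⁻¹ : (ZMod c)ˣ) : ZMod c) - (v : ZMod c))) : ℂ)) *
          ((c:ℂ) * (OO c L x : ℂ)) := by
      rw [o]
      by_cases h : (v:ZMod c) = ((x⁻¹ : (ZMod c)ˣ) : ZMod c)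
      · rw [if_pos h, if_pos h.symm]; ring
      · rw [if_neg h, if_neg (Ne.symm h)]; simp
    push_cast at this
    rw [this, OO_fourier, Finset.sum_mul_sum]
    apply Finset.sum_congr rfl
    intro m _
    apply Finset.sum_congr rfl
    intro n _
    have : m * (((x⁻¹ : (ZMod c)ˣ) : ZMod c) - (v : ZMod c)) = -m * v + m * ((x⁻¹ : (ZMod c)ˣ) : ZMod c) := by ring
    rw [this, AddChar.map_add_eq_mul, AddChar.map_add_eq_mul]
    ring
  push_cast
  rw [Finset.mul_sum]
  simp_rw [e1]
  unfold AA kl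
  simp_rw [Finset.mul_sum, Finset.sum_mul]
  rw [Finset.sum_congr rfl (fun v _ => Finset.sum_comm)]
  rw [Finset.sum_comm]
  apply Finset.sum_congr rfl
  intro m _
  rw [Finset.sum_congr rfl (fun v _ => Finset.sum_comm)]
  rw [Finset.sum_comm]
  apply Finset.sum_congr rfl
  intro n _
  rw [Finset.sum_comm]

lemma kl_zero_neg (c : ℕ) [NeZero c] (n : ZMod c) : kl c (-n) 0 = kl c n 0 := by
  unfold kl
  apply Fintype.sum_equiv (Equiv.neg (ZMod c)ˣ)
  intro x
  simp

lemma BB_neg (c : ℕ) [NeZero c] (L : ℕ) (n : ZMod c) : BB c L (-n) = - BB c L n := by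
  unfold BB
  rw [← Finset.sum_neg_distrib]
  apply Finset.sum_congr rfl
  intro l _
  rw [neg_neg]; ring

lemma BB_zero (c : ℕ) [NeZero c] (L : ℕ) : BB c L 0 = 0 := by
  simp [BB]

lemma sum_BB_kl_zero (c : ℕ) [NeZero c] (L : ℕ) : ∑ n : ZMod c, BB c L n * kl c n 0 = 0 := by
  have h : ∑ n : ZMod c, BB c L n * kl c n 0 = ∑ n : ZMod c, -(BB c L n * kl c n 0) := by
    apply Fintype.sum_equiv (Equiv.neg (ZMod c))
    intro n
    simp only [Equiv.neg_apply]
    rw [BB_neg, kl_zero_neg]; ring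
  rw [Finset.sum_neg_distrib] at h
  exact self_eq_neg.mp h

lemma AA_bound (c : ℕ) [NeZero c] (V1 V2 : ℕ) (m : ZMod c) (hm : m ≠ 0) : ‖AA c V1 V2 m‖ ≤ hh c m := by
  unfold AA
  have := geom_bound c (-m) (neg_ne_zero.mpr hm) V1 V2
  rwa [hh_neg] at this

lemma BB_bound (c : ℕ) [NeZero c] (L : ℕ) (n : ZMod c) (hn : n ≠ 0) : ‖BB c L n‖ ≤ 2 * hh c n := by
  unfold BB
  have e : Finset.Icc 1 L = Finset.Ioc 0 L := by ext; simp; omega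
  rw [Finset.sum_sub_distrib, e]
  have h1 := geom_bound c n hn 0 L
  have h2 := geom_bound c (-n) (neg_ne_zero.mpr hn) 0 L
  rw [hh_neg] at h2
  refine (norm_sub_le _ _).trans ?_
  linarith

lemma DD_bound1 (c : ℕ) [NeZero c] (L V1 V2 : ℕ) :
    |∑ v ∈ Finset.Ioc V1 V2, DD c L v| ≤
     2 * (2*(c:ℝ)^3*(c.divisors.card:ℝ)^3)^(1/4:ℝ) * ((c.divisors.card:ℝ) * (1 + Real.log c))^2 := by
  have hc : (0:ℝ) < c := by exact_mod_cast Nat.pos_of_ne_zero (NeZero.ne c)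
  set κ := (2*(c:ℝ)^3*(c.divisors.card:ℝ)^3)^(1/4:ℝ) with hκ
  have hκ0 : 0 ≤ κ := by positivity
  set X := ∑ a : ZMod c, (if a = 0 then 0 else hh c a * (Nat.gcd a.val c : ℝ)) with hX
  have hXb : X ≤ c * (c.divisors.card * (1 + Real.log c)) := sum_hh_gcd c
  have hX0 : 0 ≤ X := Finset.sum_nonneg (fun a _ => by
    split_ifs
    · exact le_rfl
    · exact mul_nonneg (hh_nonneg c a) (by positivity))
  have hY : ∑ n : ZMod c, ‖BB c L n‖ ≤ 2 * X := by
    rw [hX, Finset.mul_sum]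
    apply Finset.sum_le_sum
    intro n _
    split_ifs with h
    · rw [h, BB_zero]; simp
    · refine (BB_bound c L n h).trans ?_
      have : (1:ℝ) ≤ (Nat.gcd n.val c : ℝ) := by
        exact_mod_cast Nat.gcd_pos_of_pos_right _ (Nat.pos_of_ne_zero (NeZero.ne c))
      have := mul_le_mul_of_nonneg_left this (hh_nonneg c n)
      linarith
  have hmain : ‖∑ m : ZMod c, ∑ n : ZMod c, AA c V1 V2 m * BB c L n * kl c n m‖ ≤ X * (κ * (2 * X)) := by
    refine (norm_sum_le _ _).trans ?_
    rw [hX, Finset.sum_mul]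
    apply Finset.sum_le_sum
    intro m _
    rw [← hX]
    split_ifs with h
    · simp_rw [mul_assoc]
      rw [← Finset.mul_sum, h, sum_BB_kl_zero]; simp
    · calc _ ≤ ∑ n : ZMod c, ‖AA c V1 V2 m * BB c L n * kl c n m‖ := norm_sum_le _ _
        _ ≤ ∑ n : ZMod c, (hh c m * (Nat.gcd m.val c : ℝ) * κ) * ‖BB c L n‖ := by
            apply Finset.sum_le_sum
            intro n _
            rw [norm_mul, norm_mul]
            have h1 := AA_bound c V1 V2 m h
            have h2 := kl_bound c n m
            calc ‖AA c V1 V2 m‖ * ‖BB c L n‖ * ‖kl c n m‖ ≤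
                hh c m * ‖BB c L n‖ * ((Nat.gcd m.val c : ℝ) * κ) := by
                  have := hh_nonneg c m
                  gcongr
              _ = _ := by ring
        _ = (hh c m * (Nat.gcd m.val c : ℝ) * κ) * ∑ n : ZMod c, ‖BB c L n‖ := by rw [Finset.mul_sum]
        _ ≤ (hh c m * (Nat.gcd m.val c : ℝ) * κ) * (2 * X) := by
            apply mul_le_mul_of_nonneg_left hY
            have := hh_nonneg c m
            positivity
        _ = _ := by ring
  rw [← DD_fourier, norm_mul, Complex.norm_real, Real.norm_eq_abs] at hmain
  simp only [norm_pow, Complex.norm_natCast] at hmain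
  have h3 : X * (κ * (2 * X)) ≤ (c:ℝ)^2 * (2 * κ * ((c.divisors.card:ℝ) * (1 + Real.log c))^2) := by
    have : X * X ≤ (c * (c.divisors.card * (1 + Real.log c))) * (c * (c.divisors.card * (1 + Real.log c))) :=
      mul_le_mul hXb hXb hX0 (hX0.trans hXb)
    have := mul_le_mul_of_nonneg_left this (by positivity : 0 ≤ 2 * κ)
    nlinarith
  exact le_of_mul_le_mul_left (hmain.trans h3) (by positivity)

lemma DD_bound : ∃ C : ℝ, 0 < C ∧ ∀ (c : ℕ) [NeZero c] (L V1 V2 : ℕ),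
    |∑ v ∈ Finset.Ioc V1 V2, DD c L v| ≤ C * (c:ℝ)^(7/8:ℝ) := by
  obtain ⟨K, hK0, hK⟩ := divisor_bound (1/44) (by norm_num)
  refine ⟨2 * (2 * K^3)^(1/4:ℝ) * (K^2 * 33^2), by positivity, ?_⟩
  intro c _ L V1 V2
  refine (DD_bound1 c L V1 V2).trans ?_
  have hc1 : 1 ≤ c := Nat.pos_of_ne_zero (NeZero.ne c)
  have hc : (1:ℝ) ≤ c := by exact_mod_cast hc1
  have hc0 : (0:ℝ) < c := by linarith
  have hτ := hK c (by omega)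
  have hlog : 1 + Real.log c ≤ 33 * (c:ℝ)^(1/32:ℝ) := by
    have h1 := Real.log_le_rpow_div hc0.le (by norm_num : (0:ℝ) < 1/32)
    have h2 : (1:ℝ) ≤ (c:ℝ)^(1/32:ℝ) := Real.one_le_rpow hc (by norm_num)
    have h3 : (c:ℝ)^(1/32:ℝ) / (1/32) = 32 * (c:ℝ)^(1/32:ℝ) := by ring
    linarith
  have hlog0 : 0 ≤ 1 + Real.log c := by have := Real.log_nonneg hc; linarith
  have h1 : (2*(c:ℝ)^3*(c.divisors.card:ℝ)^3)^(1/4:ℝ) ≤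
      (2 * K^3)^(1/4:ℝ) * ((c:ℝ)^(3/4 + 3/176:ℝ)) := by
    have : (2*(c:ℝ)^3*(c.divisors.card:ℝ)^3) ≤ (2 * K^3) * ((c:ℝ)^(3 + 3/44:ℝ)) := by
      calc _ ≤ 2*(c:ℝ)^3*(K * (c:ℝ)^(1/44:ℝ))^3 := by gcongr
        _ = (2 * K^3) * ((c:ℝ)^(3:ℕ) * ((c:ℝ)^(1/44:ℝ))^3) := by ring
        _ = _ := by
          rw [← Real.rpow_natCast (c:ℝ), ← Real.rpow_natCast ((c:ℝ)^(1/44:ℝ)), ← Real.rpow_mul hc0.le,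
            ← Real.rpow_add hc0]
          norm_num
    calc _ ≤ ((2 * K^3) * ((c:ℝ)^(3 + 3/44:ℝ)))^(1/4:ℝ) := by gcongr
      _ = _ := by
        rw [Real.mul_rpow (by positivity) (by positivity), ← Real.rpow_mul hc0.le]
        norm_num
  have h2 : ((c.divisors.card:ℝ) * (1 + Real.log c))^2 ≤ (K^2 * 33^2) * (c:ℝ)^(2/44+2/32:ℝ) := by
    calc _ ≤ ((K * (c:ℝ)^(1/44:ℝ)) * (33 * (c:ℝ)^(1/32:ℝ)))^2 := by gcongr
      _ = (K^2 * 33^2) * (((c:ℝ)^(1/44:ℝ))^2 * ((c:ℝ)^(1/32:ℝ))^2) := by ring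
      _ = _ := by
        rw [← Real.rpow_natCast ((c:ℝ)^(1/44:ℝ)), ← Real.rpow_natCast ((c:ℝ)^(1/32:ℝ)), ← Real.rpow_mul hc0.le,
            ← Real.rpow_mul hc0.le, ← Real.rpow_add hc0]
        norm_num
  calc _ ≤ 2 * ((2 * K^3)^(1/4:ℝ) * ((c:ℝ)^(3/4 + 3/176:ℝ))) * ((K^2 * 33^2) * (c:ℝ)^(2/44+2/32:ℝ)) := by
        gcongr
    _ = 2 * (2 * K^3)^(1/4:ℝ) * (K^2 * 33^2) * ((c:ℝ)^(3/4 + 3/176:ℝ) * (c:ℝ)^(2/44+2/32:ℝ)) := by ring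
    _ = 2 * (2 * K^3)^(1/4:ℝ) * (K^2 * 33^2) * (c:ℝ)^((3/4 + 3/176) + (2/44+2/32):ℝ) := by
        rw [← Real.rpow_add hc0]
    _ ≤ _ := by
        apply mul_le_mul_of_nonneg_left _ (by positivity)
        apply Real.rpow_le_rpow_of_exponent_le hc
        norm_num

end DSA


namespace DSA

lemma sum_perm_mod (a b : ℕ) (hab : Nat.Coprime a b) (hb : 0 < b) (φ : ℕ → ℝ) :
    ∑ k ∈ Finset.range b, φ ((k * a) % b) = ∑ k ∈ Finset.range b, φ k := by
  have hm : ∀ k ∈ Finset.range b, (k * a) % b ∈ Finset.range b := fun k _ => by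
    simp [Nat.mod_lt _ hb]
  have hi : Set.InjOn (fun k => (k * a) % b) (Finset.range b : Set ℕ) := by
    intro x hx y hy h
    simp at hx hy
    have h' : x * a ≡ y * a [MOD b] := h
    have := Nat.ModEq.cancel_right_of_coprime (hab.symm) h'
    exact Nat.ModEq.eq_of_lt_of_lt this hx hy
  apply Finset.sum_nbij (fun k => (k * a) % b) hm hi
  · exact Finset.surjOn_of_injOn_of_card_le _ hm hi le_rfl
  · intros; rfl

noncomputable def FF (a b : ℕ) : ℝ := ∑ k ∈ Finset.range b, (k:ℝ) * ((k * a / b : ℕ) : ℝ)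

lemma sum_id (b : ℕ) : ∑ k ∈ Finset.range b, (k:ℝ) = b * (b-1) / 2 := by
  induction b with
  | zero => simp
  | succ n ih => rw [Finset.sum_range_succ, ih]; push_cast; ring

lemma sum_sq (b : ℕ) : ∑ k ∈ Finset.range b, (k:ℝ)^2 = b * (b-1) * (2*b-1) / 6 := by
  induction b with
  | zero => simp
  | succ n ih => rw [Finset.sum_range_succ, ih]; push_cast; ring

lemma mod_cast_eq (a b k : ℕ) : (((k * a) % b : ℕ) : ℝ) = k * a - b * ((k * a / b : ℕ) : ℝ) := by
  have := Nat.div_add_mod (k * a) b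
  have h : (b:ℝ) * ((k * a / b : ℕ) : ℝ) + (((k * a) % b : ℕ) : ℝ) = k * a := by exact_mod_cast this
  linarith

lemma saw_div (n b : ℕ) (h : n % b ≠ 0) (hb : 0 < b) : saw ((n:ℝ)/b) = ((n % b : ℕ):ℝ)/b - 1/2 := by
  unfold saw
  rw [Int.fract_div_natCast_eq_div_natCast_mod]
  have : ((n % b : ℕ):ℝ)/b ≠ 0 := by
    have : (b:ℝ) ≠ 0 := by positivity
    have : ((n % b : ℕ):ℝ) ≠ 0 := by exact_mod_cast h
    positivity
  rw [if_neg this]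

lemma saw_div0 (n b : ℕ) (h : n % b = 0) : saw ((n:ℝ)/b) = 0 := by
  unfold saw
  rw [Int.fract_div_natCast_eq_div_natCast_mod, h]
  simp

lemma ded_eq1 (a b : ℕ) (hab : Nat.Coprime a b) (hb : 0 < b) :
    dedekindSum a b = ∑ k ∈ Finset.range b, ((k:ℝ)/b - 1/2) * (((k * a % b : ℕ):ℝ)/b - 1/2) - 1/4 := by
  unfold dedekindSum
  have e0 : ∀ n : ℕ, saw ((n : ℝ) / ((b:ℤ) : ℝ)) * saw ((n : ℝ) * ((a:ℤ) : ℝ) / ((b:ℤ) : ℝ)) =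
      saw ((n:ℝ)/b) * saw (((n * a : ℕ):ℝ)/b) := by intro n; push_cast; rfl
  simp_rw [e0]
  rw [Int.toNat_natCast]
  have e1 : Finset.Icc 1 b = insert b (Finset.Ico 1 b) := by ext; simp; omega
  rw [e1, Finset.sum_insert (by simp), saw_div0 b b (by simp), zero_mul, zero_add]
  rw [Finset.range_eq_Ico, Finset.sum_eq_sum_Ico_succ_bot hb]
  simp only [zero_add]
  have e2 : ∑ k ∈ Finset.Ico 1 b, saw ((k:ℝ)/b) * saw (((k * a : ℕ):ℝ)/b) =
      ∑ k ∈ Finset.Ico 1 b, ((k:ℝ)/b - 1/2) * (((k * a % b : ℕ):ℝ)/b - 1/2) := by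
    apply Finset.sum_congr rfl
    intro k hk
    simp at hk
    have h1 : k % b = k := Nat.mod_eq_of_lt hk.2
    have h2 : k * a % b ≠ 0 := by
      intro h
      have : b ∣ k * a := Nat.dvd_of_mod_eq_zero h
      have := (hab.symm).dvd_of_dvd_mul_right this
      have := Nat.le_of_dvd (by omega) this
      omega
    rw [saw_div k b (by omega) hb, saw_div _ b h2 hb, h1]
  rw [e2]
  simp
  ring

lemma ded_eq2 (a b : ℕ) (hab : Nat.Coprime a b) (hb : 0 < b) :
    dedekindSum a b = (a:ℝ) * (b-1) * (2*b-1) / (6*b) - FF a b / b - (b-1)/4 := by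
  rw [ded_eq1 a b hab hb]
  have hb' : (b:ℝ) ≠ 0 := by positivity
  have e : ∀ k : ℕ, ((k:ℝ)/b - 1/2) * (((k * a % b : ℕ):ℝ)/b - 1/2) =
     (a / b^2) * (k:ℝ)^2 - (1/b) * ((k:ℝ) * ((k * a / b : ℕ) : ℝ)) - (1/(2*b)) * k
      - (1/(2*b)) * ((k*a%b : ℕ):ℝ) + 1/4 := by
    intro k
    have := mod_cast_eq a b k
    have h2 : ((k:ℝ)/b) * (((k * a % b : ℕ):ℝ)/b) = (a / b^2) * (k:ℝ)^2 - (1/b) * ((k:ℝ) * ((k * a / b : ℕ) : ℝ)) := by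
      rw [this]; field_simp
    have h3 : ((k:ℝ)/b - 1/2) * (((k * a % b : ℕ):ℝ)/b - 1/2) = ((k:ℝ)/b) * (((k * a % b : ℕ):ℝ)/b)
       - (1/(2*b)) * k - (1/(2*b)) * ((k*a%b : ℕ):ℝ) + 1/4 := by field_simp; ring
    rw [h3, h2]
  simp_rw [e]
  rw [Finset.sum_add_distrib, Finset.sum_sub_distrib, Finset.sum_sub_distrib, Finset.sum_sub_distrib,
    ← Finset.mul_sum, ← Finset.mul_sum, ← Finset.mul_sum, ← Finset.mul_sum,
    sum_perm_mod a b hab hb (fun k => (k:ℝ)), sum_id, sum_sq]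
  simp
  unfold FF
  field_simp
  ring

lemma rec1 (a b : ℕ) (hab : Nat.Coprime a b) (hb : 0 < b) :
    (a:ℝ)^2 * (b * (b-1) * (2*b-1) / 6) - 2 * a * b * FF a b +
      b^2 * ∑ k ∈ Finset.range b, ((k * a / b : ℕ) : ℝ)^2 = b * (b-1) * (2*b-1) / 6 := by
  have := sum_perm_mod a b hab hb (fun k => (k:ℝ)^2)
  simp only [mod_cast_eq] at this
  rw [← sum_sq]
  refine Eq.trans ?_ this
  unfold FF
  rw [Finset.mul_sum, Finset.mul_sum, Finset.mul_sum, ← Finset.sum_sub_distrib, ← Finset.sum_add_distrib]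
  apply Finset.sum_congr rfl
  intros; ring

lemma rec3 (a b : ℕ) (hab : Nat.Coprime a b) (hb : 0 < b) :
    ∑ k ∈ Finset.range b, ((k * a / b : ℕ) : ℝ) = (a-1)*(b-1)/2 := by
  have := sum_perm_mod a b hab hb (fun k => (k:ℝ))
  simp only [mod_cast_eq] at this
  rw [Finset.sum_sub_distrib, ← Finset.sum_mul, ← Finset.mul_sum, sum_id] at this
  have hb' : (b:ℝ) ≠ 0 := by positivity
  have h2 : (b:ℝ) * ∑ k ∈ Finset.range b, ((k * a / b : ℕ) : ℝ) = b * ((a-1)*(b-1)/2) := by linarith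
  exact mul_left_cancel₀ hb' h2

lemma rec2 (a b : ℕ) (hab : Nat.Coprime a b) (ha : 0 < a) (hb : 0 < b) :
    ∑ k ∈ Finset.range b, (((k * a / b : ℕ) : ℝ)^2 + ((k * a / b : ℕ) : ℝ)) =
      a * (a-1) * (b-1) - 2 * FF b a := by
  have e1 : ∀ k ∈ Finset.range b, (((k * a / b : ℕ) : ℝ)^2 + ((k * a / b : ℕ) : ℝ)) =
      2 * ∑ j ∈ Finset.range a, if j * b ≤ k * a then (j:ℝ) else 0 := by
    intro k hk
    simp at hk
    rw [← Finset.sum_filter]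
    have : (Finset.range a).filter (fun j => j * b ≤ k * a) = Finset.range (k * a / b + 1) := by
      ext j
      simp only [Finset.mem_filter, Finset.mem_range, Nat.lt_succ_iff, Nat.le_div_iff_mul_le hb]
      constructor
      · exact fun h => h.2
      · intro h
        refine ⟨?_, h⟩
        by_contra hc
        push Not at hc
        nlinarith
    rw [this, sum_id]; push_cast; ring
  rw [Finset.sum_congr rfl e1, ← Finset.mul_sum, Finset.sum_comm]
  have e2 : ∀ j ∈ Finset.range a, (∑ k ∈ Finset.range b, if j * b ≤ k * a then (j:ℝ) else 0) =
      (b-1) * j - (j:ℝ) * ((j * b / a : ℕ):ℝ) := by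
    intro j hj
    simp at hj
    rcases Nat.eq_zero_or_pos j with h0 | h0
    · subst h0; simp
    · rw [← Finset.sum_filter, Finset.sum_const]
      have hlt : j * b / a < b := by rw [Nat.div_lt_iff_lt_mul ha]; nlinarith
      have : (Finset.range b).filter (fun k => j * b ≤ k * a) = Finset.Ico (j * b / a + 1) b := by
        ext k
        simp only [Finset.mem_filter, Finset.mem_range, Finset.mem_Ico, Nat.succ_le_iff, Nat.div_lt_iff_lt_mul ha]
        have hne : j * b ≠ k * a := by
          intro h
          have : a ∣ j * b := ⟨k, by rw [h]; ring⟩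
          have := hab.dvd_of_dvd_mul_right this
          have := Nat.le_of_dvd h0 this
          omega
        constructor
        · rintro ⟨h1, h2⟩; exact ⟨lt_of_le_of_ne h2 hne, h1⟩
        · rintro ⟨h1, h2⟩; exact ⟨h2, h1.le⟩
      rw [this, Nat.card_Ico, nsmul_eq_mul, Nat.cast_sub (by omega)]
      push_cast; ring
  rw [Finset.sum_congr rfl e2, Finset.sum_sub_distrib, ← Finset.mul_sum, sum_id]
  unfold FF
  ring

lemma reciprocity (a b : ℕ) (hab : Nat.Coprime a b) (ha : 0 < a) (hb : 0 < b) :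
    12 * (dedekindSum a b + dedekindSum b a) = -3 + (a:ℝ)/b + b/a + 1/(a*b) := by
  rw [ded_eq2 a b hab hb, ded_eq2 b a hab.symm ha]
  have r1 := rec1 a b hab hb
  have r3 := rec3 a b hab hb
  have r2 := rec2 a b hab ha hb
  rw [Finset.sum_add_distrib, r3] at r2
  set S2 := ∑ k ∈ Finset.range b, ((k * a / b : ℕ) : ℝ)^2
  have hS : S2 = a * (a-1) * (b-1) - 2 * FF b a - (a-1)*(b-1)/2 := by linarith
  rw [hS] at r1
  have ha' : (0:ℝ) < a := by positivity
  have hb' : (0:ℝ) < b := by positivity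
  field_simp
  field_simp at r1
  nlinarith

lemma saw_add_nat (x : ℝ) (n : ℕ) : saw (x + n) = saw x := by
  unfold saw
  rw [Int.fract_add_natCast]

lemma ded_period (a b : ℕ) (hb : 0 < b) : dedekindSum ((a + b : ℕ):ℤ) b = dedekindSum a b := by
  unfold dedekindSum
  apply Finset.sum_congr rfl
  intro n _
  congr 1
  rw [← saw_add_nat ((n:ℝ) * ((a:ℤ):ℝ) / ((b:ℤ):ℝ)) n]
  congr 1
  have : (b:ℝ) ≠ 0 := by positivity
  push_cast
  field_simp

def gg (b a : ℕ) : ℤ :=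
  if h : b = 0 ∨ a = 0 ∨ a = b then 0
  else if a < b then 1 + gg (b-a) a else -1 + gg b (a-b)
termination_by a + b
decreasing_by all_goals omega

lemma gg_lt (b a : ℕ) (ha : 0 < a) (h : a < b) : gg b a = 1 + gg (b-a) a := by
  rw [gg, dif_neg (by omega), if_pos h]

lemma gg_gt (b a : ℕ) (hb : 0 < b) (h : b < a) : gg b a = -1 + gg b (a-b) := by
  rw [gg, dif_neg (by omega), if_neg (by omega)]

lemma gg_eq (b : ℕ) : gg b b = 0 := by
  rw [gg, dif_pos (by omega)]

lemma gg_mul (k : ℕ) (hk : 0 < k) : ∀ (n b a : ℕ), a + b ≤ n → 0 < a → 0 < b →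
    gg (k*b) (k*a) = gg b a := by
  intro n
  induction n with
  | zero => intros; omega
  | succ n ih =>
    intro b a hn ha hb
    rcases lt_trichotomy a b with h | h | h
    · rw [gg_lt b a ha h, gg_lt (k*b) (k*a) (by positivity) (by nlinarith), ← Nat.mul_sub,
        ih (b-a) a (by omega) ha (by omega)]
    · subst h; rw [gg_eq, gg_eq]
    · rw [gg_gt b a hb h, gg_gt (k*b) (k*a) (by positivity) (by nlinarith), ← Nat.mul_sub,
        ih b (a-b) (by omega) (by omega) hb]

lemma ded_gg : ∀ (n b a : ℕ), a + b ≤ n → 0 < a → 0 < b → Nat.Coprime a b →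
    -2 + 1/(b:ℝ) ≤ 12 * dedekindSum a b - (a:ℝ)/b - gg b a ∧
    12 * dedekindSum a b - (a:ℝ)/b - gg b a ≤ -1 := by
  intro n
  induction n with
  | zero => intros; omega
  | succ n ih =>
    intro b a hn ha hb hab
    have ha' : (0:ℝ) < a := by positivity
    have hb' : (0:ℝ) < b := by positivity
    rcases lt_trichotomy a b with h | h | h
    · have hc : Nat.Coprime a (b-a) := (Nat.coprime_sub_self_right h.le).mpr hab
      have ih' := ih (b-a) a (by omega) ha (by omega) hc
      have r1 := reciprocity a b hab ha hb
      have r2 := reciprocity a (b-a) hc ha (by omega)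
      have p := ded_period (b-a) a ha
      rw [Nat.sub_add_cancel h.le] at p
      rw [gg_lt b a ha h]
      have hcast : ((b-a:ℕ):ℝ) = b - a := by push_cast [h.le]; ring
      have hba : (0:ℝ) < b - a := by have : (a:ℝ) < b := by exact_mod_cast h
                                     linarith
      have ha1 : (1:ℝ) ≤ a := by exact_mod_cast ha
      rw [hcast] at ih' r2
      push_cast
      have key : 12 * dedekindSum a b - (a:ℝ)/b = 1 + (12 * dedekindSum a ((b-a:ℕ):ℤ) - a/(b-a)) - 1/(b*(b-a)) := by
        have e : (b:ℝ)/a + 1/(a*b) - (b-a)/a - 1/(a*(b-a)) = 1 - 1/(b*(b-a)) := by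
          field_simp; ring
        rw [p] at r1
        linarith
      rw [key]
      have hpos : 0 < 1/((b:ℝ)*(b-a)) := by positivity
      have hlow : 1/(b:ℝ) ≤ 1/(b-a) - 1/(b*(b-a)) := by
        have : 1/((b:ℝ)-a) - 1/(b*(b-a)) - 1/b = (a-1)/(b*(b-a)) := by field_simp; ring
        have : 0 ≤ ((a:ℝ)-1)/(b*(b-a)) := div_nonneg (by linarith) (by positivity)
        linarith
      constructor <;> linarith [ih'.1, ih'.2]
    · subst h
      have : a = 1 := by simpa using hab
      subst this
      rw [gg_eq, ded_eq2 1 1 hab hb]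
      norm_num [FF]
    · have hc : Nat.Coprime (a-b) b := (Nat.coprime_sub_self_left h.le).mpr hab
      have ih' := ih b (a-b) (by omega) (by omega) hb hc
      have p := ded_period (a-b) b hb
      rw [Nat.sub_add_cancel h.le] at p
      rw [gg_gt b a hb h, p]
      have hcast : ((a-b:ℕ):ℝ) = a - b := by push_cast [h.le]; ring
      rw [hcast] at ih'
      have : ((a:ℝ)-b)/b = a/b - 1 := by field_simp
      rw [this] at ih'
      push_cast
      constructor <;> linarith [ih'.1, ih'.2]

lemma ded_gg_bound (b a : ℕ) (ha : 0 < a) (hab : a ≤ b) (hc : Nat.Coprime a b) :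
    |12 * dedekindSum a b - gg b a| ≤ 3 := by
  have hb : 0 < b := by omega
  have h := ded_gg _ b a le_rfl ha hb hc
  have h1 : 0 ≤ (a:ℝ)/b := by positivity
  have h2 : (a:ℝ)/b ≤ 1 := by rw [div_le_one (by positivity)]; exact_mod_cast hab
  have h3 : 0 ≤ 1/(b:ℝ) := by positivity
  rw [abs_le]; constructor <;> linarith [h.1, h.2]

end DSA


namespace DSA

abbrev T6 := ℕ × ℕ × ℕ × ℕ × ℕ × ℕ

def box6 (N : ℕ) : Finset T6 :=
  Finset.range (N+1) ×ˢ Finset.range (N+1) ×ˢ Finset.range (N+1) ×ˢ Finset.range (N+1) ×ˢ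
    Finset.range (N+1) ×ˢ Finset.range (N+1)

def isNode (b a : ℕ) : T6 → Prop := fun t =>
  t.1 * t.2.2.2.1 = t.2.1 * t.2.2.1 + 1 ∧ 0 < t.2.2.2.2.1 ∧ 0 < t.2.2.2.2.2 ∧
  t.1 * t.2.2.2.2.1 + t.2.1 * t.2.2.2.2.2 = b ∧ t.2.2.1 * t.2.2.2.2.1 + t.2.2.2.1 * t.2.2.2.2.2 = a

instance (b a : ℕ) : DecidablePred (isNode b a) := fun t => by unfold isNode; infer_instance

def nodes (N b a : ℕ) : Finset T6 := (box6 N).filter (isNode b a)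

lemma isNode_box (N b a : ℕ) (hb : b ≤ N) (ha : a ≤ N) (t : T6) (h : isNode b a t) : t ∈ box6 N := by
  obtain ⟨p, q, r, s, m, n⟩ := t
  simp only [isNode] at h
  obtain ⟨h1, hm, hn, h2, h3⟩ := h
  have hp : 0 < p := by rcases Nat.eq_zero_or_pos p with h | h
                        · subst h; omega
                        · exact h
  have hs : 0 < s := by rcases Nat.eq_zero_or_pos s with h | h
                        · subst h; omega
                        · exact h
  simp only [box6, Finset.mem_product, Finset.mem_range]
  refine ⟨?_, ?_, ?_, ?_, ?_, ?_⟩ <;> nlinarith [Nat.zero_le (p*m), Nat.zero_le (q*n), Nat.zero_le (r*m), Nat.zero_le (s*n)]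

lemma mem_nodes (N b a : ℕ) (hb : b ≤ N) (ha : a ≤ N) (t : T6) : t ∈ nodes N b a ↔ isNode b a t := by
  unfold nodes
  rw [Finset.mem_filter]
  exact ⟨fun h => h.2, fun h => ⟨isNode_box N b a hb ha t h, h⟩⟩

def sg (m n : ℕ) : ℤ := Int.sign ((m:ℤ) - n)

def wt (t : T6) : ℤ := sg t.2.2.2.2.1 t.2.2.2.2.2

def up1 : T6 → T6 := fun t => (t.1 + t.2.2.1, t.2.1 + t.2.2.2.1, t.2.2)
def up2 : T6 → T6 := fun t => (t.1, t.2.1, t.1 + t.2.2.1, t.2.1 + t.2.2.2.1, t.2.2.2.2)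

lemma up1_inj : Function.Injective up1 := by
  rintro ⟨p, q, r, s, m, n⟩ ⟨p', q', r', s', m', n'⟩ h
  simp only [up1, Prod.mk.injEq] at h ⊢
  omega
lemma up2_inj : Function.Injective up2 := by
  rintro ⟨p, q, r, s, m, n⟩ ⟨p', q', r', s', m', n'⟩ h
  simp only [up2, Prod.mk.injEq] at h ⊢
  omega

lemma pos_of_det {p q r s : ℕ} (h : p * s = q * r + 1) : 0 < p ∧ 0 < s := by
  constructor
  · rcases Nat.eq_zero_or_pos p with h' | h'
    · subst h'; omega
    · exact h'
  · rcases Nat.eq_zero_or_pos s with h' | h'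
    · subst h'; omega
    · exact h'

lemma det_cases {p q r s : ℕ} (h : p * s = q * r + 1) :
    (p = 1 ∧ q = 0 ∧ r = 0 ∧ s = 1) ∨ (r ≤ p ∧ s ≤ q) ∨ (p ≤ r ∧ q ≤ s) := by
  obtain ⟨hp, hs⟩ := pos_of_det h
  rcases lt_trichotomy p r with h1 | h1 | h1
  · right; right
    refine ⟨h1.le, ?_⟩
    by_contra hc; push Not at hc
    nlinarith
  · subst h1
    right
    rcases le_total s q with h2 | h2
    · left; exact ⟨le_rfl, h2⟩
    · right; exact ⟨le_rfl, h2⟩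
  · by_cases h2 : s ≤ q
    · right; left; exact ⟨h1.le, h2⟩
    · left
      push Not at h2
      have h3 : (r+1)*(q+1) ≤ p * s := Nat.mul_le_mul h1 h2
      have h4 : r = 0 ∧ q = 0 := by constructor <;> nlinarith
      obtain ⟨rfl, rfl⟩ := h4
      have : p * s = 1 := by simpa using h
      have := mul_eq_one.mp this
      simp [this.1, this.2]

lemma gg_nodes (N : ℕ) : ∀ (k b a : ℕ), a + b ≤ k → 0 < a → 0 < b → b ≤ N → a ≤ N →
    gg b a = ∑ t ∈ nodes N b a, wt t := by
  intro k
  induction k with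
  | zero => intros; omega
  | succ k ih =>
    intro b a hk ha hb hbN haN
    rcases lt_trichotomy a b with h | h | h
    · rw [gg_lt b a ha h, ih (b-a) a (by omega) ha (by omega) (by omega) haN]
      have e : nodes N b a = insert (1,0,0,1,b,a) ((nodes N (b-a) a).map ⟨up1, up1_inj⟩) := by
        ext t
        rw [mem_nodes N b a hbN haN, Finset.mem_insert, Finset.mem_map]
        constructor
        · intro ht
          obtain ⟨p, q, r, s, m, n⟩ := t
          simp only [isNode] at ht
          obtain ⟨h1, hm, hn, h2, h3⟩ := ht
          rcases det_cases h1 with ⟨rfl, rfl, rfl, rfl⟩ | ⟨c1, c2⟩ | ⟨c1, c2⟩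
          · left; simp at h2 h3; simp [h2, h3]
          · right
            obtain ⟨p', rfl⟩ := Nat.exists_eq_add_of_le' c1
            obtain ⟨q', rfl⟩ := Nat.exists_eq_add_of_le' c2
            refine ⟨(p', q', r, s, m, n), ?_, rfl⟩
            rw [mem_nodes N _ _ (by omega) haN]
            simp only [isNode]
            refine ⟨by nlinarith, hm, hn, ?_, h3⟩
            have : (p' * m + q' * n) + a = b := by rw [← h2, ← h3]; ring
            omega
          · exfalso
            have := Nat.mul_le_mul_right m c1
            have := Nat.mul_le_mul_right n c2
            omega
        · rintro (rfl | ⟨t', ht', rfl⟩)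
          · simp [isNode, ha, hb]
          · obtain ⟨p, q, r, s, m, n⟩ := t'
            rw [mem_nodes N _ _ (by omega) haN] at ht'
            simp only [isNode] at ht'
            obtain ⟨h1, hm, hn, h2, h3⟩ := ht'
            simp only [isNode, up1, Function.Embedding.coeFn_mk]
            refine ⟨by nlinarith, hm, hn, ?_, h3⟩
            have : (p + r) * m + (q + s) * n = (b - a) + a := by rw [← h2, ← h3]; ring
            omega
      rw [e, Finset.sum_insert, Finset.sum_map]
      · congr 1
        simp only [wt, sg]
        symm; apply Int.sign_eq_one_of_pos; omega
      · rw [Finset.mem_map]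
        rintro ⟨⟨p, q, r, s, m, n⟩, ht', h'⟩
        rw [mem_nodes N _ _ (by omega) haN] at ht'
        simp only [isNode] at ht'
        have := pos_of_det ht'.1
        simp only [up1, Function.Embedding.coeFn_mk, Prod.mk.injEq] at h'
        omega
    · subst h
      rw [gg_eq]
      symm
      apply Finset.sum_eq_zero
      intro t ht
      rw [mem_nodes N _ _ (by omega) haN] at ht
      obtain ⟨p, q, r, s, m, n⟩ := t
      simp only [isNode] at ht
      obtain ⟨h1, hm, hn, h2, h3⟩ := ht
      have hmn : m = n := by
        obtain ⟨hp, hs⟩ := pos_of_det h1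
        rcases det_cases h1 with ⟨rfl, rfl, rfl, rfl⟩ | ⟨c1, c2⟩ | ⟨c1, c2⟩
        · omega
        · exfalso
          have e1 := Nat.mul_le_mul_right m c1
          have e2 := Nat.mul_le_mul_right n c2
          have e3 : r * m = p * m := by omega
          have e4 : s * n = q * n := by omega
          have := Nat.eq_of_mul_eq_mul_right hm e3
          have := Nat.eq_of_mul_eq_mul_right hn e4
          subst_vars
          nlinarith
        · exfalso
          have e1 := Nat.mul_le_mul_right m c1
          have e2 := Nat.mul_le_mul_right n c2
          have e3 : r * m = p * m := by omega
          have e4 : s * n = q * n := by omega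
          have := Nat.eq_of_mul_eq_mul_right hm e3
          have := Nat.eq_of_mul_eq_mul_right hn e4
          subst_vars
          nlinarith
      simp [wt, sg, hmn]
    · rw [gg_gt b a hb h, ih b (a-b) (by omega) (by omega) hb hbN (by omega)]
      have e : nodes N b a = insert (1,0,0,1,b,a) ((nodes N b (a-b)).map ⟨up2, up2_inj⟩) := by
        ext t
        rw [mem_nodes N b a hbN haN, Finset.mem_insert, Finset.mem_map]
        constructor
        · intro ht
          obtain ⟨p, q, r, s, m, n⟩ := t
          simp only [isNode] at ht
          obtain ⟨h1, hm, hn, h2, h3⟩ := ht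
          rcases det_cases h1 with ⟨rfl, rfl, rfl, rfl⟩ | ⟨c1, c2⟩ | ⟨c1, c2⟩
          · left; simp at h2 h3; simp [h2, h3]
          · exfalso
            have := Nat.mul_le_mul_right m c1
            have := Nat.mul_le_mul_right n c2
            omega
          · right
            obtain ⟨r', rfl⟩ := Nat.exists_eq_add_of_le c1
            obtain ⟨s', rfl⟩ := Nat.exists_eq_add_of_le c2
            refine ⟨(p, q, r', s', m, n), ?_, rfl⟩
            rw [mem_nodes N _ _ hbN (by omega)]
            simp only [isNode]
            refine ⟨by nlinarith, hm, hn, h2, ?_⟩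
            have : (r' * m + s' * n) + b = a := by rw [← h2, ← h3]; ring
            omega
        · rintro (rfl | ⟨t', ht', rfl⟩)
          · simp [isNode, ha, hb]
          · obtain ⟨p, q, r, s, m, n⟩ := t'
            rw [mem_nodes N _ _ hbN (by omega)] at ht'
            simp only [isNode] at ht'
            obtain ⟨h1, hm, hn, h2, h3⟩ := ht'
            simp only [isNode, up2, Function.Embedding.coeFn_mk]
            refine ⟨by nlinarith, hm, hn, h2, ?_⟩
            have : (p + r) * m + (q + s) * n = (a - b) + b := by rw [← h3, ← h2]; ring
            omega
      rw [e, Finset.sum_insert, Finset.sum_map]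
      · congr 1
        simp only [wt, sg]
        symm; apply Int.sign_eq_neg_one_of_neg; omega
      · rw [Finset.mem_map]
        rintro ⟨⟨p, q, r, s, m, n⟩, ht', h'⟩
        rw [mem_nodes N _ _ hbN (by omega)] at ht'
        simp only [isNode] at ht'
        have := pos_of_det ht'.1
        simp only [up2, Function.Embedding.coeFn_mk, Prod.mk.injEq] at h'
        omega

end DSA


namespace DSA

noncomputable def TT (v0 w Q : ℕ) : ℝ :=
  ∑ b ∈ Finset.Icc 1 Q, ∑ a ∈ Finset.Icc 1 Q, if w * a < v0 * b then (gg b a : ℝ) else 0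

def good (v0 w Q : ℕ) (t : T6) : Prop :=
  t.1 * t.2.2.2.1 = t.2.1 * t.2.2.1 + 1 ∧ 0 < t.2.2.2.2.1 ∧ 0 < t.2.2.2.2.2 ∧
  t.1 * t.2.2.2.2.1 + t.2.1 * t.2.2.2.2.2 ≤ Q ∧
  w * (t.2.2.1 * t.2.2.2.2.1 + t.2.2.2.1 * t.2.2.2.2.2) < v0 * (t.1 * t.2.2.2.2.1 + t.2.1 * t.2.2.2.2.2)

instance (v0 w Q : ℕ) : DecidablePred (good v0 w Q) := fun t => by unfold good; infer_instance

lemma TT_eq1 (v0 w Q : ℕ) (hw : v0 ≤ w) :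
    TT v0 w Q = ∑ t ∈ box6 Q, if good v0 w Q t then (wt t : ℝ) else 0 := by
  have e1 : TT v0 w Q = ∑ b ∈ Finset.Icc 1 Q, ∑ a ∈ Finset.Icc 1 Q, ∑ t ∈ box6 Q,
      (if w * a < v0 * b ∧ isNode b a t then (wt t : ℝ) else 0) := by
    unfold TT
    apply Finset.sum_congr rfl
    intro b hb
    apply Finset.sum_congr rfl
    intro a ha
    simp at hb ha
    split_ifs with h
    · rw [gg_nodes Q _ b a le_rfl ha.1 hb.1 hb.2 ha.2]
      unfold nodes
      rw [Finset.sum_filter]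
      push_cast
      apply Finset.sum_congr rfl
      intro t _
      simp [h]
    · symm
      apply Finset.sum_eq_zero
      intro t _
      simp [h]
  rw [e1]
  rw [Finset.sum_congr rfl (fun b _ => Finset.sum_comm), Finset.sum_comm]
  apply Finset.sum_congr rfl
  intro t _
  obtain ⟨p, q, r, s, m, n⟩ := t
  split_ifs with h
  · simp only [good] at h
    obtain ⟨h1, hm, hn, h2, h3⟩ := h
    have hs := (pos_of_det h1).2
    have hsn : 0 < s * n := by positivity
    have hlt : r * m + s * n < p * m + q * n := by
      by_contra hc
      push Not at hc
      have := Nat.mul_le_mul hw hc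
      omega
    rw [Finset.sum_eq_single (p * m + q * n), Finset.sum_eq_single (r * m + s * n)]
    · rw [if_pos]
      exact ⟨h3, h1, hm, hn, rfl, rfl⟩
    · intro a _ ha
      rw [if_neg]
      rintro ⟨_, h⟩
      simp only [isNode] at h
      exact ha h.2.2.2.2.symm
    · intro hx; exfalso; apply hx; simp; omega
    · intro b _ hb
      apply Finset.sum_eq_zero
      intro a _
      rw [if_neg]
      rintro ⟨_, h⟩
      simp only [isNode] at h
      exact hb h.2.2.2.1.symm
    · intro hx; exfalso; apply hx; simp; omega
  · apply Finset.sum_eq_zero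
    intro b hb
    apply Finset.sum_eq_zero
    intro a _
    rw [if_neg]
    rintro ⟨h0, h1⟩
    apply h
    simp only [isNode] at h1
    obtain ⟨h1, hm, hn, h2, h3⟩ := h1
    simp at hb
    simp only [good]
    rw [h2, h3]
    exact ⟨h1, hm, hn, hb.2, h0⟩

noncomputable def ff (Q u v : ℕ) : ℝ :=
  ∑ m ∈ Finset.Icc 1 Q, ∑ n ∈ Finset.Icc 1 Q, if u * m + v * n ≤ Q then (sg m n : ℝ) else 0

noncomputable def inn (v0 w Q p q r s : ℕ) : ℝ :=
  ∑ m ∈ Finset.Icc 1 Q, ∑ n ∈ Finset.Icc 1 Q,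
    if p * m + q * n ≤ Q ∧ w * (r * m + s * n) < v0 * (p * m + q * n) then (sg m n : ℝ) else 0

lemma sum_range_Icc (Q : ℕ) (F : ℕ → ℝ) (h0 : F 0 = 0) :
    ∑ m ∈ Finset.range (Q+1), F m = ∑ m ∈ Finset.Icc 1 Q, F m := by
  rw [Finset.sum_range_succ', h0, add_zero, Finset.range_eq_Ico, Finset.sum_Ico_add' F 0 Q 1]
  rfl

lemma TT_eq2 (v0 w Q : ℕ) (hw : v0 ≤ w) :
    TT v0 w Q = ∑ p ∈ Finset.range (Q+1), ∑ q ∈ Finset.range (Q+1), ∑ r ∈ Finset.range (Q+1),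
      ∑ s ∈ Finset.range (Q+1), if p * s = q * r + 1 then inn v0 w Q p q r s else 0 := by
  rw [TT_eq1 v0 w Q hw]
  unfold box6
  simp only [Finset.sum_product]
  apply Finset.sum_congr rfl; intro p _
  apply Finset.sum_congr rfl; intro q _
  apply Finset.sum_congr rfl; intro r _
  apply Finset.sum_congr rfl; intro s _
  rw [sum_range_Icc]
  · split_ifs with h
    · unfold inn
      apply Finset.sum_congr rfl
      intro m hm
      rw [sum_range_Icc]
      · apply Finset.sum_congr rfl
        intro n hn
        simp at hm hn
        simp only [good, wt]
        have : 0 < m := hm.1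
        have : 0 < n := hn.1
        simp [h, *]
      · simp [good]
    · apply Finset.sum_eq_zero
      intro m _
      apply Finset.sum_eq_zero
      intro n _
      simp [good, h]
  · apply Finset.sum_eq_zero
    intro n _
    simp [good]

lemma sg_abs (m n : ℕ) : |(sg m n : ℝ)| ≤ 1 := by
  unfold sg
  rcases lt_trichotomy ((m:ℤ) - n) 0 with h | h | h
  · rw [Int.sign_eq_neg_one_of_neg h]; norm_num
  · rw [h]; norm_num
  · rw [Int.sign_eq_one_of_pos h]; norm_num

lemma abs_sum_box (Q : ℕ) (F : ℕ → ℕ → ℝ) (h : ∀ m n, |F m n| ≤ 1) :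
    |∑ m ∈ Finset.Icc 1 Q, ∑ n ∈ Finset.Icc 1 Q, F m n| ≤ (Q:ℝ)^2 := by
  calc _ ≤ ∑ m ∈ Finset.Icc 1 Q, |∑ n ∈ Finset.Icc 1 Q, F m n| := Finset.abs_sum_le_sum_abs _ _
    _ ≤ ∑ m ∈ Finset.Icc 1 Q, ∑ n ∈ Finset.Icc 1 Q, |F m n| :=
        Finset.sum_le_sum (fun m _ => Finset.abs_sum_le_sum_abs _ _)
    _ ≤ ∑ m ∈ Finset.Icc 1 Q, ∑ n ∈ Finset.Icc 1 Q, (1:ℝ) :=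
        Finset.sum_le_sum (fun m _ => Finset.sum_le_sum (fun n _ => h m n))
    _ = _ := by simp; ring

lemma ff_abs (Q u v : ℕ) : |ff Q u v| ≤ (Q:ℝ)^2 := by
  apply abs_sum_box
  intro m n
  split_ifs
  · exact sg_abs m n
  · simp

lemma inn_abs (v0 w Q p q r s : ℕ) : |inn v0 w Q p q r s| ≤ (Q:ℝ)^2 := by
  apply abs_sum_box
  intro m n
  split_ifs
  · exact sg_abs m n
  · simp

lemma inn_A (v0 w Q p q r s : ℕ) (hv0 : 0 < v0) (h : p * s = q * r + 1) (hA : s * w ≤ v0 * q) :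
    inn v0 w Q p q r s = ff Q p q := by
  unfold inn ff
  apply Finset.sum_congr rfl
  intro m hm
  apply Finset.sum_congr rfl
  intro n hn
  simp at hm hn
  obtain ⟨hp, hs⟩ := pos_of_det h
  have hmain : w * (r * m + s * n) < v0 * (p * m + q * n) := by
    have h2 : r * w < v0 * p := by
      rcases Nat.eq_zero_or_pos w with h0 | h0
      · subst h0; rw [mul_zero]; positivity
      have hq : 0 < q := by
        rcases Nat.eq_zero_or_pos q with h' | h'
        · subst h'
          have : 0 < s * w := by positivity
          omega
        · exact h'
      have e1 : (q * r + 1) * w = p * (s * w) := by rw [← h]; ring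
      have e2 : p * (s * w) ≤ p * (v0 * q) := Nat.mul_le_mul_left p hA
      have e3 : q * (r * w) < q * (v0 * p) := by nlinarith
      exact lt_of_mul_lt_mul_left e3 (Nat.zero_le q)
    have e1 : (r * w + 1) * m ≤ v0 * p * m := Nat.mul_le_mul_right m h2
    have e2 : s * w * n ≤ v0 * q * n := Nat.mul_le_mul_right n hA
    nlinarith
  simp [hmain]

lemma inn_C (v0 w Q p q r s : ℕ) (hA : v0 * q ≤ s * w) (hC : v0 * p ≤ r * w) :
    inn v0 w Q p q r s = 0 := by
  unfold inn
  apply Finset.sum_eq_zero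
  intro m _
  apply Finset.sum_eq_zero
  intro n _
  rw [if_neg]
  rintro ⟨_, h⟩
  have e1 := Nat.mul_le_mul_right m hC
  have e2 := Nat.mul_le_mul_right n hA
  nlinarith

noncomputable def EE (v0 w Q : ℕ) (p q : ℕ) : ℝ :=
  ∑ r ∈ Finset.range (Q+1), ∑ s ∈ Finset.range (Q+1), if p * s = q * r + 1 ∧ s * w ≤ v0 * q then 1 else 0

lemma bad_box (v0 w p q r s : ℕ) (hv0 : 0 < v0) (hw : v0 < w) (h : p * s = q * r + 1)
    (hb : (v0 * q < s * w ∧ r * w < v0 * p) ∨ (s * w ≤ v0 * q ∧ p < w ∧ q < w)) :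
    p < w^2+2 ∧ q < w^2+2 ∧ r < w^2+2 ∧ s < w^2+2 := by
  obtain ⟨hp, hs⟩ := pos_of_det h
  have hww : w ≤ w^2 := by nlinarith
  rcases hb with ⟨h1, h2⟩ | ⟨h1, h2, h3⟩
  · obtain ⟨X, hX⟩ := Nat.exists_eq_add_of_lt h2
    obtain ⟨Y, hY⟩ := Nat.exists_eq_add_of_lt h1
    have hXY : q * (X+1) + p * (Y+1) = w := by
      have e1 : p * (s * w) = p * (v0 * q) + p * (Y+1) := by rw [hY]; ring
      have e2 : q * (v0 * p) = q * (r * w) + q * (X+1) := by rw [hX]; ring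
      have e3 : p * (s * w) = q * (r * w) + w := by
        calc p * (s * w) = (p * s) * w := by ring
          _ = _ := by rw [h]; ring
      have e4 : p * (v0 * q) = q * (v0 * p) := by ring
      omega
    have hpw : p ≤ w := by nlinarith [Nat.zero_le (q * (X+1)), Nat.zero_le (p * Y)]
    have hqw : q ≤ w := by nlinarith [Nat.zero_le (p * (Y+1)), Nat.zero_le (q * X)]
    have hr : r < p := by
      by_contra hc
      push Not at hc
      have := Nat.mul_le_mul hc hw.le
      nlinarith
    have hsb : s ≤ q * r + 1 := by rw [← h]; nlinarith
    have : q * r ≤ w * w := Nat.mul_le_mul hqw (by omega)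
    refine ⟨by omega, by omega, by omega, ?_⟩
    nlinarith
  · have hsq : s < q := by
      by_contra hc
      push Not at hc
      have h4 := Nat.mul_le_mul hc hw
      have hq : 0 < q ∨ q = 0 := by omega
      nlinarith
    have : r ≤ q * r := by nlinarith
    have : p * s ≤ w * w := Nat.mul_le_mul h2.le (by omega)
    refine ⟨by omega, by omega, by nlinarith, by omega⟩

lemma TT_eq3 (v0 w Q : ℕ) (hv0 : 0 < v0) (hw : v0 < w) :
    |TT v0 w Q - ∑ p ∈ Finset.range (Q+1), ∑ q ∈ Finset.range (Q+1),
      (if w ≤ p ∨ w ≤ q then EE v0 w Q p q * ff Q p q else 0)| ≤ ((w:ℝ)^2+2)^4 * (Q:ℝ)^2 := by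
  have e1 : ∑ p ∈ Finset.range (Q+1), ∑ q ∈ Finset.range (Q+1),
      (if w ≤ p ∨ w ≤ q then EE v0 w Q p q * ff Q p q else 0) =
      ∑ p ∈ Finset.range (Q+1), ∑ q ∈ Finset.range (Q+1), ∑ r ∈ Finset.range (Q+1),
      ∑ s ∈ Finset.range (Q+1), if p * s = q * r + 1 then
        (if s * w ≤ v0 * q ∧ (w ≤ p ∨ w ≤ q) then ff Q p q else 0) else 0 := by
    apply Finset.sum_congr rfl; intro p _
    apply Finset.sum_congr rfl; intro q _
    split_ifs with h
    · unfold EE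
      rw [Finset.sum_mul]
      apply Finset.sum_congr rfl; intro r _
      rw [Finset.sum_mul]
      apply Finset.sum_congr rfl; intro s _
      by_cases h1 : p * s = q * r + 1 <;> by_cases h2 : s * w ≤ v0 * q <;> simp [h1, h2, h]
    · symm
      apply Finset.sum_eq_zero; intro r _
      apply Finset.sum_eq_zero; intro s _
      simp [h]
  rw [e1, TT_eq2 v0 w Q hw.le]
  simp only [← Finset.sum_sub_distrib]
  set W := w^2+2 with hW
  have key : ∀ p q r s : ℕ, |(if p * s = q * r + 1 then inn v0 w Q p q r s else 0) -
      (if p * s = q * r + 1 then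
        (if s * w ≤ v0 * q ∧ (w ≤ p ∨ w ≤ q) then ff Q p q else 0) else 0)| ≤
      (if p < W then (if q < W then (if r < W then (if s < W then (Q:ℝ)^2 else 0) else 0) else 0) else 0) := by
    intro p q r s
    by_cases hb : p < W ∧ q < W ∧ r < W ∧ s < W
    · rw [if_pos hb.1, if_pos hb.2.1, if_pos hb.2.2.1, if_pos hb.2.2.2]
      split_ifs with h h'
      · rw [inn_A v0 w Q p q r s hv0 h h'.1]; simp
      · simpa using inn_abs v0 w Q p q r s
      · simp
    · have hR : 0 ≤ (if p < W then (if q < W then (if r < W then (if s < W then (Q:ℝ)^2 else 0) else 0) else 0) else 0) := by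
        split_ifs <;> positivity
      refine le_trans (le_of_eq ?_) hR
      split_ifs with h h'
      · rw [inn_A v0 w Q p q r s hv0 h h'.1]; simp
      · rw [sub_zero, abs_eq_zero]
        by_cases hA : s * w ≤ v0 * q
        · exfalso; apply hb
          apply bad_box v0 w p q r s hv0 hw h
          right
          refine ⟨hA, ?_⟩
          by_contra hc
          apply h'
          exact ⟨hA, by omega⟩
        · push Not at hA
          by_cases hC : v0 * p ≤ r * w
          · exact inn_C v0 w Q p q r s hA.le hC
          · exfalso; apply hb
            apply bad_box v0 w p q r s hv0 hw h
            left; exact ⟨hA, by omega⟩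
      · simp
  have habs : ∀ (s : Finset ℕ) (F G : ℕ → ℝ), (∀ i, |F i| ≤ G i) → |∑ i ∈ s, F i| ≤ ∑ i ∈ s, G i :=
    fun s F G h => (Finset.abs_sum_le_sum_abs _ _).trans (Finset.sum_le_sum (fun i _ => h i))
  have hcnt : ∀ (X : ℝ), 0 ≤ X → ∑ i ∈ Finset.range (Q+1), (if i < W then X else 0) ≤ W * X := by
    intro X hX
    rw [← Finset.sum_filter, Finset.sum_const, nsmul_eq_mul]
    apply mul_le_mul_of_nonneg_right _ hX
    have : ((Finset.range (Q+1)).filter (fun i => i < W)).card ≤ (Finset.range W).card :=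
      Finset.card_le_card (fun i hi => by simp at hi ⊢; exact hi.2)
    rw [Finset.card_range] at this
    exact_mod_cast this
  have hpull : ∀ (P : Prop) [Decidable P] (F : ℕ → ℝ), ∑ i ∈ Finset.range (Q+1), (if P then F i else 0) =
      if P then ∑ i ∈ Finset.range (Q+1), F i else 0 := by
    intro P _ F
    split_ifs <;> simp
  refine (habs _ _ _ (fun p => habs _ _ _ (fun q => habs _ _ _ (fun r => habs _ _ _ (fun s => key p q r s))))).trans ?_
  simp only [hpull]
  have mono : ∀ (X Y : ℝ), X ≤ Y → ∀ i, (if i < W then X else 0) ≤ (if i < W then Y else 0) := by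
    intro X Y h i; split_ifs <;> simp [h]
  have c1 := hcnt ((Q:ℝ)^2) (by positivity)
  have c2 := (Finset.sum_le_sum (s := Finset.range (Q+1)) (fun i _ => mono _ _ c1 i)).trans
    (hcnt (W * (Q:ℝ)^2) (by positivity))
  have c3 := (Finset.sum_le_sum (s := Finset.range (Q+1)) (fun i _ => mono _ _ c2 i)).trans
    (hcnt (W * (W * (Q:ℝ)^2)) (by positivity))
  have c4 := (Finset.sum_le_sum (s := Finset.range (Q+1)) (fun i _ => mono _ _ c3 i)).trans
    (hcnt (W * (W * (W * (Q:ℝ)^2))) (by positivity))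
  refine c4.trans (le_of_eq ?_)
  rw [hW]; push_cast; ring

end DSA


namespace DSA

lemma DD_eq (c : ℕ) [NeZero c] (L : ℕ) (v : ZMod c) :
    DD c L v = ∑ l ∈ Finset.Icc 1 L, ((if v * (l : ZMod c) = -1 then 1 else 0) -
      (if v * (l : ZMod c) = 1 then 1 else 0)) := by
  unfold DD
  by_cases h : IsUnit v
  · obtain ⟨y, rfl⟩ := h
    rw [Finset.sum_eq_single y⁻¹]
    · rw [inv_inv, if_pos rfl]
      unfold OO
      apply Finset.sum_congr rfl
      intro l _
      have e1 : (((y⁻¹ : (ZMod c)ˣ) : ZMod c) = -(l : ZMod c)) ↔ ((y : ZMod c) * (l : ZMod c) = -1) := by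
        constructor
        · intro h
          have : (y : ZMod c) * ((y⁻¹ : (ZMod c)ˣ) : ZMod c) = 1 := by simp
          rw [h] at this
          linear_combination -this
        · intro h
          have : ((y⁻¹ : (ZMod c)ˣ) : ZMod c) * ((y : ZMod c) * (l : ZMod c)) = (l : ZMod c) := by simp
          rw [h] at this
          linear_combination -this
      have e2 : (((y⁻¹ : (ZMod c)ˣ) : ZMod c) = (l : ZMod c)) ↔ ((y : ZMod c) * (l : ZMod c) = 1) := by
        constructor
        · intro h
          have : (y : ZMod c) * ((y⁻¹ : (ZMod c)ˣ) : ZMod c) = 1 := by simp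
          rw [h] at this
          exact this
        · intro h
          have : ((y⁻¹ : (ZMod c)ˣ) : ZMod c) * ((y : ZMod c) * (l : ZMod c)) = (l : ZMod c) := by simp
          rw [h] at this
          linear_combination this
      simp only [e1, e2]
    · intro x _ hx
      rw [if_neg]
      intro h
      apply hx
      have : y = x⁻¹ := Units.ext h
      rw [this, inv_inv]
    · simp
  · rw [Finset.sum_eq_zero, Finset.sum_eq_zero]
    · intro l _
      rw [if_neg, if_neg, sub_zero]
      · intro h'; exact h (IsUnit.of_mul_eq_one _ h')
      · intro h'; exact h (IsUnit.of_mul_eq_one (-(l : ZMod c)) (by linear_combination -h'))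
    · intro x _
      rw [if_neg]
      intro h'; exact h (h' ▸ Units.isUnit _)

lemma sum_square (G : ℕ → ℕ → ℝ) (N : ℕ) : ∑ p ∈ Finset.range N, ∑ q ∈ Finset.range N, G p q =
    ∑ v ∈ Finset.range N, ((∑ u ∈ Finset.range v, (G u v + G v u)) + G v v) := by
  induction N with
  | zero => simp
  | succ N ih =>
    rw [Finset.sum_range_succ, Finset.sum_range_succ _ N, Finset.sum_range_succ _ N, ← ih]
    simp_rw [Finset.sum_range_succ _ N, Finset.sum_add_distrib]
    ring

lemma ff_anti (Q u v : ℕ) : ff Q v u = - ff Q u v := by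
  unfold ff
  rw [Finset.sum_comm, ← Finset.sum_neg_distrib]
  apply Finset.sum_congr rfl; intro m _
  rw [← Finset.sum_neg_distrib]
  apply Finset.sum_congr rfl; intro n _
  rw [add_comm (v * n)]
  split_ifs
  · unfold sg
    rw [← neg_sub (n:ℤ) m, Int.sign_neg]; simp
  · simp

lemma ff_self (Q u : ℕ) : ff Q u u = 0 := by
  have := ff_anti Q u u
  linarith

open Classical in
lemma sum_unique_ite (S : Finset ℕ) (P : ℕ → Prop) [DecidablePred P] (h : ∀ r r', P r → P r' → r = r') :
    ∑ r ∈ S, (if P r then (1:ℝ) else 0) = if ∃ r ∈ S, P r then 1 else 0 := by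
  split_ifs with hx
  · obtain ⟨r, hr, hP⟩ := hx
    rw [Finset.sum_eq_single r]
    · rw [if_pos hP]
    · intro b _ hb
      rw [if_neg]
      intro h'; exact hb (h _ _ h' hP)
    · intro h'; exact absurd hr h'
  · apply Finset.sum_eq_zero
    intro r hr
    rw [if_neg]
    intro h'; exact hx ⟨r, hr, h'⟩

lemma EE_zero_left (v0 w Q v : ℕ) : EE v0 w Q 0 v = 0 := by
  unfold EE; simp

lemma EE_right_small (v0 w Q v u : ℕ) (hu : u ≤ 1) (hw : v0 < w) : EE v0 w Q v u = 0 := by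
  unfold EE
  apply Finset.sum_eq_zero; intro r _
  apply Finset.sum_eq_zero; intro s _
  rw [if_neg]
  rintro ⟨h1, h2⟩
  have hs := (pos_of_det h1).2
  have : v0 * u ≤ v0 * 1 := Nat.mul_le_mul_left _ hu
  have : 1 * w ≤ s * w := Nat.mul_le_mul_right _ hs
  omega

lemma EE_one_left (v0 w Q v : ℕ) (hv0 : 0 < v0) (hw : v0 < w) (hv : w ≤ v) (hQ : v ≤ Q) :
    EE v0 w Q 1 v = 1 := by
  unfold EE
  rw [Finset.sum_eq_single 0, Finset.sum_eq_single 1]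
  · rw [if_pos]
    refine ⟨by simp, ?_⟩
    nlinarith
  · intro s _ hs
    rw [if_neg]
    rintro ⟨h, _⟩
    simp at h; exact hs h
  · intro h; exfalso; apply h; simp; omega
  · intro r _ hr
    apply Finset.sum_eq_zero; intro s _
    rw [if_neg]
    rintro ⟨h1, h2⟩
    have : 0 < r := Nat.pos_of_ne_zero hr
    have h3 : v + 1 ≤ s := by nlinarith
    have h4 := Nat.mul_le_mul h3 hw.le
    nlinarith
  · intro h; exfalso; apply h; simp

/-- cut-off -/
def LL (v0 w u : ℕ) : ℕ := (v0 * u - 1) / w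

lemma le_LL (v0 w u l : ℕ) (hv0 : 0 < v0) (hu : 0 < u) (hw : 0 < w) : l ≤ LL v0 w u ↔ l * w < v0 * u := by
  unfold LL
  rw [Nat.le_div_iff_mul_le hw]
  have : 0 < v0 * u := by positivity
  omega

open Classical in
lemma EE_left (v0 w Q u v : ℕ) (hv0 : 0 < v0) (hw : v0 < w) (hu : 2 ≤ u) (huv : u < v) (hv : w ≤ v) (hQ : v ≤ Q) :
    EE v0 w Q u v = ∑ l ∈ Finset.Icc 1 (LL v0 w u), (if (v : ZMod u) * (l : ZMod u) = -1 then (1:ℝ) else 0) := by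
  unfold EE
  have e1 : ∀ r ∈ Finset.range (Q+1), ∑ s ∈ Finset.range (Q+1),
      (if u * s = v * r + 1 ∧ s * w ≤ v0 * v then (1:ℝ) else 0) =
      if (1 ≤ r ∧ r ≤ LL v0 w u) then (if (v : ZMod u) * (r : ZMod u) = -1 then (1:ℝ) else 0) else 0 := by
    intro r _
    rw [sum_unique_ite _ _ (fun s s' h h' => by
      have : u * s = u * s' := by rw [h.1, h'.1]
      exact Nat.eq_of_mul_eq_mul_left (by omega) this)]
    rw [← ite_and]
    congr 1
    rw [eq_iff_iff, le_LL v0 w u r hv0 (by omega) (by omega)]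
    have hz : ((v : ZMod u) * (r : ZMod u) = -1) ↔ u ∣ v * r + 1 := by
      rw [← ZMod.natCast_eq_zero_iff]
      push_cast
      constructor
      · intro h; rw [h]; ring
      · intro h; linear_combination h
    rw [hz]
    constructor
    · rintro ⟨s, _, h1, h2⟩
      refine ⟨⟨?_, ?_⟩, ⟨s, h1.symm⟩⟩
      · by_contra hc
        have : r = 0 := by omega
        subst this
        have := Nat.eq_one_of_mul_eq_one_right (by simpa using h1 : u * s = 1)
        omega
      · have h3 : u * (s * w) ≤ u * (v0 * v) := Nat.mul_le_mul_left u h2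
        have h4 : u * (s * w) = v * (r * w) + w := by
          calc u * (s * w) = (u * s) * w := by ring
            _ = _ := by rw [h1]; ring
        have h5 : v * (r * w) < v * (v0 * u) := by nlinarith
        exact lt_of_mul_lt_mul_left h5 (Nat.zero_le v)
    · rintro ⟨⟨h1, h2⟩, s, hs⟩
      have h3 : s * w ≤ v0 * v := by
        have h4 : v * (r * w + 1) ≤ v * (v0 * u) := Nat.mul_le_mul_left v h2
        have h5 : u * (s * w) = v * (r * w) + w := by
          calc u * (s * w) = (u * s) * w := by ring
            _ = _ := by rw [← hs]; ring
        have h6 : u * (s * w) ≤ u * (v0 * v) := by nlinarith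
        exact le_of_mul_le_mul_left h6 (by omega)
      refine ⟨s, ?_, hs.symm, h3⟩
      simp
      by_contra hc
      have : v + 1 ≤ s := by omega
      have := Nat.mul_le_mul this hw.le
      nlinarith
  rw [Finset.sum_congr rfl e1, ← Finset.sum_filter]
  apply Finset.sum_congr _ (fun _ _ => rfl)
  ext l
  simp only [Finset.mem_filter, Finset.mem_range, Finset.mem_Icc]
  constructor
  · exact fun h => h.2
  · intro h
    refine ⟨?_, h⟩
    have := (le_LL v0 w u l hv0 (by omega) (by omega)).mp h.2
    have : l < u := by
      by_contra hc
      push Not at hc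
      have := Nat.mul_le_mul hc hw.le
      nlinarith
    omega

open Classical in
lemma EE_right (v0 w Q u v : ℕ) (hv0 : 0 < v0) (hw : v0 < w) (hcop : Nat.Coprime v0 w)
    (hu : 2 ≤ u) (huv : u < v) (hQ : v ≤ Q) :
    EE v0 w Q v u = ∑ l ∈ Finset.Icc 1 (LL v0 w u), (if (v : ZMod u) * (l : ZMod u) = 1 then (1:ℝ) else 0)
     + (if u = w ∧ (v * v0) % w = 1 then 1 else 0) := by
  have hz : ∀ s : ℕ, ((v : ZMod u) * (s : ZMod u) = 1) ↔ (v * s) % u = 1 := by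
    intro s
    have : ((v : ZMod u) * (s : ZMod u) = 1) ↔ (((v * s : ℕ) : ZMod u) = ((1:ℕ) : ZMod u)) := by
      push_cast; rfl
    rw [this, ZMod.natCast_eq_natCast_iff']
    rw [Nat.mod_eq_of_lt (by omega : 1 < u)]
  unfold EE
  rw [Finset.sum_comm]
  have e1 : ∀ s ∈ Finset.range (Q+1), ∑ r ∈ Finset.range (Q+1),
      (if v * s = u * r + 1 ∧ s * w ≤ v0 * u then (1:ℝ) else 0) =
      (if (1 ≤ s ∧ s ≤ LL v0 w u) then (if (v : ZMod u) * (s : ZMod u) = 1 then (1:ℝ) else 0) else 0) +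
      (if s = v0 then (if u = w ∧ (v * v0) % w = 1 then 1 else 0) else 0) := by
    intro s _
    rw [sum_unique_ite _ _ (fun r r' h h' => by
      have : u * r = u * r' := by have := h.1; have := h'.1; omega
      exact Nat.eq_of_mul_eq_mul_left (by omega) this)]
    simp only [le_LL v0 w u s hv0 (by omega : 0 < u) (by omega : 0 < w), hz]
    have hex : (∃ r ∈ Finset.range (Q+1), v * s = u * r + 1 ∧ s * w ≤ v0 * u) ↔
        (s * w ≤ v0 * u ∧ (v * s) % u = 1) := by
      constructor
      · rintro ⟨r, _, h1, h2⟩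
        refine ⟨h2, ?_⟩
        rw [h1, Nat.mul_add_mod, Nat.mod_eq_of_lt (by omega)]
      · rintro ⟨h1, h2⟩
        have hd := Nat.div_add_mod (v * s) u
        rw [h2] at hd
        have hsu : s < u := by
          by_contra hc
          push Not at hc
          have := Nat.mul_le_mul hc hw
          nlinarith
        refine ⟨v * s / u, ?_, hd.symm, h1⟩
        rw [Finset.mem_range]
        have : v * s / u < v := by
          rw [Nat.div_lt_iff_lt_mul (by omega)]
          exact Nat.mul_lt_mul_of_pos_left hsu (by omega)
        omega
    rw [if_congr hex rfl rfl]
    have hpos : (v * s) % u = 1 → 1 ≤ s := by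
      intro h
      by_contra hc
      have : s = 0 := by omega
      subst this
      simp at h
    have hdeg : s * w = v0 * u → (v * s) % u = 1 → u = w ∧ s = v0 := by
      intro h1 h2
      have hwu : w ∣ u := by
        have : w ∣ v0 * u := ⟨s, by rw [← h1]; ring⟩
        exact hcop.symm.dvd_of_dvd_mul_left this
      obtain ⟨k, rfl⟩ := hwu
      have hs : s = v0 * k := by
        have : s * w = (v0 * k) * w := by rw [h1]; ring
        exact Nat.eq_of_mul_eq_mul_right (by omega) this
      have hk : k ∣ 1 := by
        have h3 : k ∣ (v * s) % (w * k) := by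
          rw [Nat.dvd_mod_iff (Dvd.intro_left w rfl)]
          rw [hs]; exact ⟨v * v0, by ring⟩
        rwa [h2] at h3
      have : k = 1 := Nat.dvd_one.mp hk
      subst this
      simp [hs]
    by_cases h2 : (v * s) % u = 1
    · have h1 := hpos h2
      rcases lt_trichotomy (s * w) (v0 * u) with h | h | h
      · rw [if_pos ⟨h.le, h2⟩, if_pos ⟨h1, h⟩, if_pos h2]
        have : ¬ (s = v0 ∧ u = w ∧ (v * v0) % w = 1) := by
          rintro ⟨rfl, rfl, _⟩
          omega
        rw [← ite_and, if_neg this]; simp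
      · obtain ⟨rfl, rfl⟩ := hdeg h h2
        simp [h2]
      · rw [if_neg (by omega), if_neg (by omega)]
        have : ¬ (s = v0 ∧ u = w ∧ (v * v0) % w = 1) := by
          rintro ⟨rfl, rfl, _⟩
          omega
        rw [← ite_and, if_neg this]; simp
    · rw [if_neg (by tauto), if_neg h2]
      have : ¬ (s = v0 ∧ u = w ∧ (v * v0) % w = 1) := by
        rintro ⟨rfl, rfl, h⟩
        exact h2 h
      rw [← ite_and _ _ _ (0:ℝ), if_neg this]; simp
  rw [Finset.sum_congr rfl e1, Finset.sum_add_distrib, ← Finset.sum_filter]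
  congr 1
  · apply Finset.sum_congr _ (fun _ _ => rfl)
    ext l
    simp only [Finset.mem_filter, Finset.mem_range, Finset.mem_Icc]
    constructor
    · exact fun h => h.2
    · intro h
      refine ⟨?_, h⟩
      have := (le_LL v0 w u l hv0 (by omega) (by omega)).mp h.2
      have : l < u := by
        by_contra hc
        push Not at hc
        have := Nat.mul_le_mul hc hw.le
        nlinarith
      omega
  · rw [Finset.sum_ite_eq']
    by_cases h : u = w ∧ (v * v0) % w = 1
    · rw [if_pos h, if_pos]
      rw [Finset.mem_range]; omega
    · rw [if_neg h]; simp

end DSA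


namespace DSA

noncomputable def DDn (u L v : ℕ) : ℝ :=
  ∑ l ∈ Finset.Icc 1 L, ((if (v : ZMod u) * (l : ZMod u) = -1 then 1 else 0) -
      (if (v : ZMod u) * (l : ZMod u) = 1 then 1 else 0))

lemma DDn_bound : ∃ C : ℝ, 0 < C ∧ ∀ (c : ℕ), 0 < c → ∀ (L V1 V2 : ℕ),
    |∑ v ∈ Finset.Ioc V1 V2, DDn c L v| ≤ C * (c:ℝ)^(7/8:ℝ) := by
  obtain ⟨C, hC, h⟩ := DD_bound
  refine ⟨C, hC, ?_⟩
  intro c hc L V1 V2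
  haveI : NeZero c := ⟨by omega⟩
  have := h c L V1 V2
  simp only [DD_eq] at this
  exact this

lemma pair_eq (v0 w Q u v : ℕ) (hv0 : 0 < v0) (hw : v0 < w) (hcop : Nat.Coprime v0 w)
    (huv : u < v) (hv : w ≤ v) (hQ : v ≤ Q) :
    EE v0 w Q u v * ff Q u v + EE v0 w Q v u * ff Q v u =
     (if u = 1 then ff Q 1 v else 0) + (if 2 ≤ u then ff Q u v * DDn u (LL v0 w u) v else 0) -
     (if u = w then (if (v * v0) % w = 1 then ff Q w v else 0) else 0) := by
  rw [ff_anti Q u v]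
  rcases Nat.lt_or_ge u 2 with h | h
  · rcases (by omega : u = 0 ∨ u = 1) with rfl | rfl
    · rw [EE_zero_left, EE_right_small v0 w Q v 0 (by omega) hw, if_neg (by omega), if_neg (by omega),
        if_neg (by omega)]
      simp
    · rw [EE_one_left v0 w Q v hv0 hw hv hQ, EE_right_small v0 w Q v 1 (by omega) hw, if_pos rfl,
        if_neg (by omega), if_neg (by omega)]
      simp
  · rw [EE_left v0 w Q u v hv0 hw h huv hv hQ, EE_right v0 w Q u v hv0 hw hcop h huv hQ,
      if_neg (by omega : ¬ u = 1), if_pos h]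
    unfold DDn
    rw [Finset.sum_sub_distrib]
    by_cases h1 : u = w
    · subst h1
      by_cases h2 : (v * v0) % u = 1
      · simp only [h2, and_self, if_true]; ring
      · simp only [h2, and_false, if_false, if_true]; ring
    · simp only [h1, false_and, if_false]; ring

lemma TT_eq4 (v0 w Q : ℕ) (hv0 : 0 < v0) (hw : v0 < w) (hcop : Nat.Coprime v0 w) :
    |TT v0 w Q - ((∑ v ∈ Finset.range (Q+1), if w ≤ v then ff Q 1 v else 0) +
      (∑ u ∈ Finset.range (Q+1), if 2 ≤ u then (∑ v ∈ Finset.range (Q+1),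
        if w ≤ v ∧ u < v then ff Q u v * DDn u (LL v0 w u) v else 0) else 0) -
      (∑ v ∈ Finset.range (Q+1), if w < v ∧ (v * v0) % w = 1 then ff Q w v else 0))|
      ≤ ((w:ℝ)^2+2)^4 * (Q:ℝ)^2 := by
  have h := TT_eq3 v0 w Q hv0 hw
  rw [sum_square] at h
  convert h using 3
  have e1 : ∀ v ∈ Finset.range (Q+1),
    ((∑ u ∈ Finset.range v, ((if w ≤ u ∨ w ≤ v then EE v0 w Q u v * ff Q u v else 0) +
      (if w ≤ v ∨ w ≤ u then EE v0 w Q v u * ff Q v u else 0))) +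
      (if w ≤ v ∨ w ≤ v then EE v0 w Q v v * ff Q v v else 0)) =
    (if w ≤ v then ff Q 1 v else 0) + (∑ u ∈ Finset.range (Q+1), if 2 ≤ u then
        (if w ≤ v ∧ u < v then ff Q u v * DDn u (LL v0 w u) v else 0) else 0) -
      (if w < v ∧ (v * v0) % w = 1 then ff Q w v else 0) := by
    intro v hv
    rw [Finset.mem_range] at hv
    rw [ff_self, mul_zero, ite_self, add_zero]
    by_cases hwv : w ≤ v
    · have e2 : ∀ u ∈ Finset.range v, ((if w ≤ u ∨ w ≤ v then EE v0 w Q u v * ff Q u v else 0) +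
        (if w ≤ v ∨ w ≤ u then EE v0 w Q v u * ff Q v u else 0)) =
        ((if u = 1 then ff Q 1 v else 0) + (if 2 ≤ u then ff Q u v * DDn u (LL v0 w u) v else 0) -
     (if u = w then (if (v * v0) % w = 1 then ff Q w v else 0) else 0)) := by
        intro u hu
        rw [Finset.mem_range] at hu
        rw [if_pos (Or.inr hwv), if_pos (Or.inl hwv)]
        exact pair_eq v0 w Q u v hv0 hw hcop hu hwv (by omega)
      rw [Finset.sum_congr rfl e2, Finset.sum_sub_distrib, Finset.sum_add_distrib,
        Finset.sum_ite_eq', Finset.sum_ite_eq', if_pos (by rw [Finset.mem_range]; omega), if_pos hwv]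
      congr 1
      · congr 1
        rw [← Finset.sum_subset (Finset.range_mono (by omega : v ≤ Q+1))]
        · apply Finset.sum_congr rfl
          intro u hu
          rw [Finset.mem_range] at hu
          simp [hwv, hu]
        · intro u _ hu
          rw [Finset.mem_range] at hu
          simp [hu]
      · rw [ite_and]
        simp [Finset.mem_range]
    · rw [if_neg hwv, if_neg (by omega)]
      rw [Finset.sum_eq_zero, Finset.sum_eq_zero]
      · simp
      · intro u _; simp [hwv]
      · intro u hu
        rw [Finset.mem_range] at hu
        rw [if_neg (by omega), if_neg (by omega), add_zero]
  rw [Finset.sum_congr rfl e1, Finset.sum_sub_distrib, Finset.sum_add_distrib]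
  congr 2
  rw [Finset.sum_comm]
  apply Finset.sum_congr rfl
  intro u _
  split_ifs
  · rfl
  · simp

noncomputable def f1 (Q u v : ℕ) : ℝ :=
  ∑ k ∈ Finset.Icc 1 Q, ∑ n ∈ Finset.Icc 1 Q, if u * k + (u + v) * n ≤ Q then 1 else 0

lemma sum_shift (Q n : ℕ) (P : ℕ → Prop) [DecidablePred P] (hP : ∀ m, P m → m ≤ Q) :
    ∑ m ∈ Finset.Icc 1 Q, (if n < m ∧ P m then (1:ℝ) else 0) =
    ∑ k ∈ Finset.Icc 1 Q, (if P (n + k) then (1:ℝ) else 0) := by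
  rw [← Finset.sum_filter, ← Finset.sum_filter]
  symm
  apply Finset.sum_bij (fun k _ => n + k)
  · intro k hk
    simp only [Finset.mem_filter, Finset.mem_Icc] at hk ⊢
    have := hP _ hk.2
    exact ⟨⟨by omega, by omega⟩, by omega, hk.2⟩
  · intros; omega
  · intro m hm
    simp only [Finset.mem_filter, Finset.mem_Icc] at hm
    obtain ⟨h1, h2, h3⟩ := hm
    refine ⟨m - n, ?_, by omega⟩
    simp only [Finset.mem_filter, Finset.mem_Icc]
    rw [Nat.add_sub_cancel' h2.le]
    exact ⟨⟨by omega, by omega⟩, h3⟩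
  · intros; rfl

lemma ff_eq (Q u v : ℕ) (hu : 0 < u) (hv : 0 < v) : ff Q u v = f1 Q u v - f1 Q v u := by
  have e : ff Q u v = (∑ m ∈ Finset.Icc 1 Q, ∑ n ∈ Finset.Icc 1 Q, if n < m ∧ u * m + v * n ≤ Q then (1:ℝ) else 0)
     - (∑ m ∈ Finset.Icc 1 Q, ∑ n ∈ Finset.Icc 1 Q, if m < n ∧ u * m + v * n ≤ Q then (1:ℝ) else 0) := by
    unfold ff
    rw [← Finset.sum_sub_distrib]
    apply Finset.sum_congr rfl; intro m _
    rw [← Finset.sum_sub_distrib]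
    apply Finset.sum_congr rfl; intro n _
    by_cases h : u * m + v * n ≤ Q
    · simp only [h, and_true, if_true]
      unfold sg
      rcases lt_trichotomy m n with h' | h' | h'
      · rw [Int.sign_eq_neg_one_of_neg (by omega), if_neg (by omega), if_pos h']; norm_num
      · subst h'; simp
      · rw [Int.sign_eq_one_of_pos (by omega), if_neg (by omega : ¬ m < n), if_pos h']; norm_num
    · simp [h]
  rw [e]
  congr 1
  · rw [Finset.sum_comm]
    unfold f1
    rw [Finset.sum_comm (s := Finset.Icc 1 Q) (t := Finset.Icc 1 Q) (f := fun k n => if u * k + (u + v) * n ≤ Q then (1:ℝ) else 0)]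
    apply Finset.sum_congr rfl; intro n _
    rw [sum_shift Q n (fun m => u * m + v * n ≤ Q) (fun m hm => by nlinarith)]
    apply Finset.sum_congr rfl; intro k _
    have : u * (n + k) + v * n = u * k + (u + v) * n := by ring
    rw [this]
  · unfold f1
    rw [Finset.sum_comm (s := Finset.Icc 1 Q) (t := Finset.Icc 1 Q) (f := fun k n => if v * k + (v + u) * n ≤ Q then (1:ℝ) else 0)]
    apply Finset.sum_congr rfl; intro m _
    rw [sum_shift Q m (fun n => u * m + v * n ≤ Q) (fun n hn => by nlinarith)]
    apply Finset.sum_congr rfl; intro k _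
    have : u * m + v * (m + k) = v * k + (v + u) * m := by ring
    rw [this]

end DSA


namespace DSA

lemma filter_antitone (P : ℕ → Prop) [DecidablePred P] (hP : ∀ a b, a ≤ b → P b → P a) (V1 Q : ℕ) :
    ∃ V2, (Finset.Ioc V1 Q).filter P = Finset.Ioc V1 V2 := by
  induction Q with
  | zero => exact ⟨0, by simp⟩
  | succ Q ih =>
    by_cases h : P (Q+1)
    · refine ⟨Q+1, ?_⟩
      apply Finset.filter_true_of_mem
      intro x hx
      simp at hx
      exact hP _ _ hx.2 h
    · obtain ⟨V2, h2⟩ := ih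
      refine ⟨V2, ?_⟩
      rw [← h2]
      ext x
      simp only [Finset.mem_filter, Finset.mem_Ioc]
      constructor
      · rintro ⟨⟨h3, h4⟩, h5⟩
        refine ⟨⟨h3, ?_⟩, h5⟩
        by_contra hc
        have : x = Q+1 := by omega
        subst this; exact h h5
      · rintro ⟨⟨h3, h4⟩, h5⟩
        exact ⟨⟨h3, by omega⟩, h5⟩

lemma count_le (Q u : ℕ) (hu : 0 < u) (X : ℝ) (hX : 0 ≤ X) :
    ∑ k ∈ Finset.Icc 1 Q, (if u * k ≤ Q then X else 0) ≤ (Q:ℝ)/u * X := by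
  rw [← Finset.sum_filter, Finset.sum_const, nsmul_eq_mul]
  apply mul_le_mul_of_nonneg_right _ hX
  have : ((Finset.Icc 1 Q).filter (fun k => u * k ≤ Q)).card ≤ (Finset.Icc 1 (Q/u)).card := by
    apply Finset.card_le_card
    intro k hk
    simp only [Finset.mem_filter, Finset.mem_Icc] at hk ⊢
    exact ⟨hk.1.1, (Nat.le_div_iff_mul_le hu).mpr (by rw [mul_comm]; exact hk.2)⟩
  rw [Nat.card_Icc] at this
  calc (_:ℝ) ≤ ((Q/u : ℕ):ℝ) := by
        have h2 : ((Finset.Icc 1 Q).filter (fun k => u * k ≤ Q)).card ≤ Q/u := by simpa using this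
        exact_mod_cast h2
    _ ≤ _ := Nat.cast_div_le

lemma kloo_gen (Q u w : ℕ) (hu : 0 < u) (hw : 0 < w) (P : ℕ → ℕ → ℕ → Prop) [∀ k n, DecidablePred (P k n)]
    (hP : ∀ k n a b, a ≤ b → P k n b → P k n a)
    (hP2 : ∀ k n v, u < v → P k n v → u * k ≤ Q ∧ u * n ≤ Q)
    (D : ℕ → ℝ) (B : ℝ) (hB0 : 0 ≤ B) (hB : ∀ V1 V2, |∑ v ∈ Finset.Ioc V1 V2, D v| ≤ B) :
    |∑ v ∈ Finset.range (Q+1), if w ≤ v ∧ u < v then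
      (∑ k ∈ Finset.Icc 1 Q, ∑ n ∈ Finset.Icc 1 Q, if P k n v then (1:ℝ) else 0) * D v else 0| ≤
      ((Q:ℝ)/u)^2 * B := by
  have e1 : (Finset.range (Q+1)).filter (fun v => w ≤ v ∧ u < v) = Finset.Ioc (max u (w-1)) Q := by
    ext v; simp only [Finset.mem_filter, Finset.mem_range, Finset.mem_Ioc]; omega
  rw [← Finset.sum_filter, e1]
  simp_rw [Finset.sum_mul]
  rw [Finset.sum_comm]
  rw [Finset.sum_congr rfl (fun k _ => Finset.sum_comm)]
  have e2 : ∀ k n, |∑ v ∈ Finset.Ioc (max u (w-1)) Q, (if P k n v then (1:ℝ) else 0) * D v| ≤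
      if u * k ≤ Q then (if u * n ≤ Q then B else 0) else 0 := by
    intro k n
    have : ∑ v ∈ Finset.Ioc (max u (w-1)) Q, (if P k n v then (1:ℝ) else 0) * D v =
        ∑ v ∈ (Finset.Ioc (max u (w-1)) Q).filter (P k n), D v := by
      rw [Finset.sum_filter]
      apply Finset.sum_congr rfl
      intro v _
      split_ifs <;> simp
    rw [this]
    by_cases h : u * k ≤ Q ∧ u * n ≤ Q
    · rw [if_pos h.1, if_pos h.2]
      obtain ⟨V2, hV⟩ := filter_antitone (P k n) (hP k n) (max u (w-1)) Q
      rw [hV]; exact hB _ _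
    · rw [Finset.filter_false_of_mem]
      · simp only [Finset.sum_empty, abs_zero]
        split_ifs <;> simp [hB0]
      · intro v hv hPv
        simp at hv
        exact h (hP2 k n v (by omega) hPv)
  calc _ ≤ ∑ k ∈ Finset.Icc 1 Q, ∑ n ∈ Finset.Icc 1 Q,
        |∑ v ∈ Finset.Ioc (max u (w-1)) Q, (if P k n v then (1:ℝ) else 0) * D v| :=
        (Finset.abs_sum_le_sum_abs _ _).trans (Finset.sum_le_sum (fun k _ => Finset.abs_sum_le_sum_abs _ _))
    _ ≤ ∑ k ∈ Finset.Icc 1 Q, ∑ n ∈ Finset.Icc 1 Q, (if u * k ≤ Q then (if u * n ≤ Q then B else 0) else 0) :=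
        Finset.sum_le_sum (fun k _ => Finset.sum_le_sum (fun n _ => e2 k n))
    _ ≤ ∑ k ∈ Finset.Icc 1 Q, (if u * k ≤ Q then (Q:ℝ)/u * B else 0) := by
        apply Finset.sum_le_sum
        intro k _
        split_ifs
        · exact count_le Q u hu B hB0
        · simp
    _ ≤ (Q:ℝ)/u * ((Q:ℝ)/u * B) := count_le Q u hu _ (by positivity)
    _ = _ := by ring

lemma S3_bound : ∃ C : ℝ, 0 < C ∧ ∀ (v0 w Q : ℕ), 0 < w →
    |∑ u ∈ Finset.range (Q+1), if 2 ≤ u then (∑ v ∈ Finset.range (Q+1),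
        if w ≤ v ∧ u < v then ff Q u v * DDn u (LL v0 w u) v else 0) else 0| ≤ C * (Q:ℝ)^2 := by
  obtain ⟨C, hC, hD⟩ := DDn_bound
  have hsum : Summable (fun n : ℕ => (n:ℝ)^(-9/8:ℝ)) := Real.summable_nat_rpow.mpr (by norm_num)
  set S := ∑' n : ℕ, (n:ℝ)^(-9/8:ℝ) with hS
  have hS0 : 0 ≤ S := tsum_nonneg (fun n => by positivity)
  refine ⟨2 * C * S + 1, by positivity, ?_⟩
  intro v0 w Q hw
  have key : ∀ u, |if 2 ≤ u then (∑ v ∈ Finset.range (Q+1),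
        if w ≤ v ∧ u < v then ff Q u v * DDn u (LL v0 w u) v else 0) else 0| ≤
        2 * C * (Q:ℝ)^2 * (u:ℝ)^(-9/8:ℝ) := by
    intro u
    split_ifs with h
    · have hu : 0 < u := by omega
      have hu' : (0:ℝ) < u := by exact_mod_cast hu
      have e : ∑ v ∈ Finset.range (Q+1), (if w ≤ v ∧ u < v then ff Q u v * DDn u (LL v0 w u) v else 0) =
          (∑ v ∈ Finset.range (Q+1), if w ≤ v ∧ u < v then f1 Q u v * DDn u (LL v0 w u) v else 0) -
          (∑ v ∈ Finset.range (Q+1), if w ≤ v ∧ u < v then f1 Q v u * DDn u (LL v0 w u) v else 0) := by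
        rw [← Finset.sum_sub_distrib]
        apply Finset.sum_congr rfl
        intro v _
        split_ifs with hv
        · rw [ff_eq Q u v hu (by omega)]; ring
        · simp
      rw [e]
      have b1 := kloo_gen Q u w hu hw (fun k n v => u * k + (u + v) * n ≤ Q)
        (fun k n a b hab h => by
          have := Nat.mul_le_mul_right n (by omega : u + a ≤ u + b)
          omega)
        (fun k n v huv h => by
          have := Nat.mul_le_mul_right n (by omega : u ≤ u + v)
          omega)
        (DDn u (LL v0 w u)) (C * (u:ℝ)^(7/8:ℝ)) (by positivity) (fun V1 V2 => hD u hu _ V1 V2)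
      have b2 := kloo_gen Q u w hu hw (fun k n v => v * k + (v + u) * n ≤ Q)
        (fun k n a b hab h => by
          have := Nat.mul_le_mul_right n (by omega : a + u ≤ b + u)
          have := Nat.mul_le_mul_right k hab
          omega)
        (fun k n v huv h => by
          have := Nat.mul_le_mul_right n (by omega : u ≤ v + u)
          have := Nat.mul_le_mul_right k huv.le
          omega)
        (DDn u (LL v0 w u)) (C * (u:ℝ)^(7/8:ℝ)) (by positivity) (fun V1 V2 => hD u hu _ V1 V2)
      have hpow : ((Q:ℝ)/u)^2 * (C * (u:ℝ)^(7/8:ℝ)) = C * (Q:ℝ)^2 * (u:ℝ)^(-9/8:ℝ) := by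
        have : (u:ℝ)^(-9/8:ℝ) = (u:ℝ)^(7/8:ℝ) / (u:ℝ)^2 := by
          rw [← Real.rpow_natCast, ← Real.rpow_sub hu']; norm_num
        rw [this]; field_simp
      rw [hpow] at b1 b2
      refine (abs_sub _ _).trans ?_
      unfold f1
      linarith
    · simp; positivity
  calc _ ≤ ∑ u ∈ Finset.range (Q+1), 2 * C * (Q:ℝ)^2 * (u:ℝ)^(-9/8:ℝ) :=
        (Finset.abs_sum_le_sum_abs _ _).trans (Finset.sum_le_sum (fun u _ => key u))
    _ = 2 * C * (Q:ℝ)^2 * ∑ u ∈ Finset.range (Q+1), (u:ℝ)^(-9/8:ℝ) := by rw [Finset.mul_sum]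
    _ ≤ 2 * C * (Q:ℝ)^2 * S := by
        apply mul_le_mul_of_nonneg_left _ (by positivity)
        exact hsum.sum_le_tsum _ (fun i _ => by positivity)
    _ ≤ _ := by nlinarith [sq_nonneg (Q:ℝ)]

end DSA


namespace DSA

lemma inner_count (Q u c n : ℕ) (hu : 0 < u) :
    (∑ k ∈ Finset.Icc 1 Q, if u * k + c * n ≤ Q then (1:ℝ) else 0) = (((Q - c*n)/u : ℕ):ℝ) := by
  rw [← Finset.sum_filter, Finset.sum_const, nsmul_eq_mul, mul_one]
  have : (Finset.Icc 1 Q).filter (fun k => u * k + c * n ≤ Q) = Finset.Icc 1 ((Q - c*n)/u) := by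
    ext k
    simp only [Finset.mem_filter, Finset.mem_Icc]
    rw [Nat.le_div_iff_mul_le hu, mul_comm k u]
    constructor
    · rintro ⟨h1, h2⟩
      exact ⟨h1.1, by omega⟩
    · rintro ⟨h1, h2⟩
      have : 1 * k ≤ u * k := Nat.mul_le_mul_right k hu
      have : 0 < u * k := by positivity
      exact ⟨⟨h1, by omega⟩, by omega⟩
  rw [this]; simp

lemma sum_lin (Q c : ℝ) (M : ℕ) : ∑ n ∈ Finset.Icc 1 M, (Q - c * n) = Q * M - c * M * (M+1)/2 := by
  induction M with
  | zero => simp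
  | succ m ih => rw [Finset.sum_Icc_succ_top (by omega), ih]; push_cast; ring

lemma f1_main (Q u v : ℕ) (hu : 0 < u) :
    |f1 Q u v - (Q:ℝ)^2/(2*u*(u+v))| ≤ 2*(Q:ℝ) := by
  set c := u + v with hc
  have hc0 : 0 < c := by omega
  set M := Q / c with hM
  have e : f1 Q u v = ∑ n ∈ Finset.Icc 1 M, (((Q - c*n)/u : ℕ):ℝ) := by
    unfold f1
    rw [Finset.sum_comm]
    simp_rw [← hc, inner_count Q u c _ hu]
    symm
    apply Finset.sum_subset
    · apply Finset.Icc_subset_Icc_right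
      exact Nat.div_le_self _ _
    · intro n hn hn2
      simp only [Finset.mem_Icc, not_and, not_le] at hn hn2
      have := hn2 hn.1
      rw [hM, Nat.div_lt_iff_lt_mul hc0, mul_comm] at this
      rw [Nat.sub_eq_zero_of_le this.le]; simp
  have hu' : (1:ℝ) ≤ u := by exact_mod_cast hu
  have hc' : (0:ℝ) < c := by exact_mod_cast hc0
  have hMQ : (c:ℝ) * M ≤ Q := by exact_mod_cast Nat.mul_div_le Q c
  have hMQ2 : (Q:ℝ) < c * M + c := by
    have := Nat.lt_mul_div_succ Q hc0
    have h2 : (Q:ℝ) < ((c * (Q/c+1) : ℕ):ℝ) := by exact_mod_cast this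
    push_cast [← hM] at h2
    linarith
  have hterm : ∀ n ∈ Finset.Icc 1 M, (((Q - c*n)/u : ℕ):ℝ) ≤ ((Q:ℝ) - c*n)/u ∧
      ((Q:ℝ) - c*n)/u - 1 ≤ (((Q - c*n)/u : ℕ):ℝ) := by
    intro n hn
    simp only [Finset.mem_Icc] at hn
    have h1 : c * n ≤ Q := (Nat.mul_le_mul_left c hn.2).trans (Nat.mul_div_le Q c)
    have h2 : ((Q - c*n : ℕ):ℝ) = (Q:ℝ) - c*n := by push_cast [h1]; ring
    rw [← h2]
    refine ⟨Nat.cast_div_le, ?_⟩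
    have := Nat.lt_mul_div_succ (Q - c*n) hu
    have h3 : ((Q - c*n : ℕ):ℝ) < u * (((Q - c*n)/u : ℕ):ℝ) + u := by
      have : ((Q - c*n : ℕ):ℝ) < ((u * ((Q-c*n)/u+1) : ℕ):ℝ) := by exact_mod_cast this
      push_cast at this
      push_cast
      linarith
    rw [sub_le_iff_le_add, div_le_iff₀ (by linarith)]
    nlinarith
  have hS := sum_lin Q c M
  have up : f1 Q u v ≤ (Q * M - c * M * (M+1)/2 : ℝ)/u := by
    rw [e, ← hS, Finset.sum_div]
    exact Finset.sum_le_sum fun n hn => (hterm n hn).1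
  have lo : (Q * M - c * M * (M+1)/2 : ℝ)/u - M ≤ f1 Q u v := by
    rw [e, ← hS, Finset.sum_div]
    calc _ = ∑ n ∈ Finset.Icc 1 M, (((Q:ℝ) - c*n)/u - 1) := by
          rw [Finset.sum_sub_distrib]; simp
      _ ≤ _ := Finset.sum_le_sum fun n hn => (hterm n hn).2
  have key : (Q * M - c * M * (M+1)/2 : ℝ) = (Q:ℝ)^2/(2*c) - ((Q - c*M)^2/(2*c) + c * M/2) := by
    field_simp; ring
  set R : ℝ := (Q - c*M)^2/(2*c) + c * M/2 with hR
  have hR0 : 0 ≤ R := by positivity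
  have hQ0 : (0:ℝ) ≤ Q := by positivity
  have hR1 : R ≤ Q := by
    have : ((Q:ℝ) - c*M)^2/(2*c) ≤ (Q - c*M)/2 := by
      rw [div_le_div_iff₀ (by positivity) (by norm_num)]
      nlinarith
    rw [hR]; linarith
  have hMle : (M:ℝ) ≤ Q := by
    have : M ≤ Q := Nat.div_le_self _ _
    exact_mod_cast this
  have e2 : (Q:ℝ)^2/(2*u*(u+v)) = (Q:ℝ)^2/(2*c)/u := by
    rw [hc]; push_cast; rw [div_div]; congr 1; ring
  have hRu : R/u ≤ Q := (div_le_self hR0 hu').trans hR1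
  have hRu0 : 0 ≤ R/u := by positivity
  rw [key, sub_div] at up lo
  rw [e2, abs_le]
  constructor <;> linarith

lemma f1_le (Q u v : ℕ) (hv : 0 < v) : 0 ≤ f1 Q v u ∧ f1 Q v u ≤ (Q:ℝ)^2 * (1/(v:ℝ)^2) := by
  constructor
  · unfold f1; positivity
  · unfold f1
    calc _ ≤ ∑ k ∈ Finset.Icc 1 Q, (if v * k ≤ Q then (Q:ℝ)/v * 1 else 0) := by
          apply Finset.sum_le_sum
          intro k _
          split_ifs with h
          · refine le_trans ?_ (count_le Q v hv 1 (by norm_num))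
            apply Finset.sum_le_sum
            intro n _
            have := Nat.mul_le_mul_right n (by omega : v ≤ v + u)
            split_ifs <;> first | omega | norm_num
          · apply le_of_eq
            apply Finset.sum_eq_zero
            intro n _
            rw [if_neg]; omega
      _ ≤ (Q:ℝ)/v * ((Q:ℝ)/v * 1) := count_le Q v hv _ (by positivity)
      _ = _ := by field_simp

lemma ap_eq (Q u ρ : ℕ) (hρ : ρ < u) (φ : ℕ → ℝ) :
    ∑ v ∈ (Finset.range (Q+1)).filter (fun v => v % u = ρ), φ v =
      ∑ j ∈ Finset.range ((Q+u-ρ)/u), φ (ρ + u*j) := by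
  have hu : 0 < u := by omega
  have : (Finset.range (Q+1)).filter (fun v => v % u = ρ) =
      (Finset.range ((Q+u-ρ)/u)).image (fun j => ρ + u*j) := by
    ext v
    simp only [Finset.mem_filter, Finset.mem_range, Finset.mem_image]
    have hj : ∀ j, j < (Q+u-ρ)/u ↔ ρ + u*j ≤ Q := by
      intro j
      rw [Nat.lt_iff_add_one_le, Nat.le_div_iff_mul_le hu, add_mul, mul_comm j u]
      omega
    constructor
    · rintro ⟨h1, h2⟩
      have h3 := Nat.mod_add_div v u
      refine ⟨v/u, (hj _).mpr (by omega), by omega⟩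
    · rintro ⟨j, h1, rfl⟩
      have := (hj j).mp h1
      refine ⟨by omega, ?_⟩
      rw [Nat.add_mul_mod_self_left, Nat.mod_eq_of_lt hρ]
  rw [this, Finset.sum_image]
  intro a _ b _ h
  simp only at h
  have : u * a = u * b := by omega
  exact Nat.eq_of_mul_eq_mul_left hu this

lemma ap_harm (Q u ρ : ℕ) (hρ : ρ < u) (hQ : 1 ≤ Q) :
    |(u:ℝ) * (∑ v ∈ (Finset.range (Q+1)).filter (fun v => v % u = ρ), 1/((u:ℝ)+v)) - Real.log Q| ≤ 2 + u := by
  have hu : 0 < u := by omega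
  have hu' : (1:ℝ) ≤ u := by exact_mod_cast hu
  rw [ap_eq Q u ρ hρ (fun v => 1/((u:ℝ)+v)), Finset.mul_sum]
  set J := (Q+u-ρ)/u with hJ
  have hρ' : (ρ:ℝ) ≤ u := by exact_mod_cast hρ.le
  have hQ' : (1:ℝ) ≤ Q := by exact_mod_cast hQ
  have hharm : ∀ n : ℕ, ((harmonic n : ℚ) : ℝ) = ∑ j ∈ Finset.range n, 1/((j:ℝ)+1) := by
    intro n
    unfold harmonic
    push_cast
    simp [one_div]
  have up : ∑ j ∈ Finset.range J, (u:ℝ) * (1/((u:ℝ)+((ρ + u*j : ℕ):ℝ))) ≤ harmonic J := by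
    rw [hharm]
    apply Finset.sum_le_sum
    intro j _
    rw [mul_one_div, div_le_div_iff₀ (by positivity) (by positivity)]
    push_cast
    nlinarith [(by positivity : (0:ℝ) ≤ ρ)]
  have lo : (harmonic (J+1) : ℝ) - 1 ≤ ∑ j ∈ Finset.range J, (u:ℝ) * (1/((u:ℝ)+((ρ + u*j : ℕ):ℝ))) := by
    rw [hharm, Finset.sum_range_succ']
    norm_num
    apply Finset.sum_le_sum
    intro j _
    rw [← one_div, ← div_eq_mul_inv, div_le_div_iff₀ (by positivity) (by positivity)]
    nlinarith
  have h1 := harmonic_le_one_add_log J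
  have h2 := log_add_one_le_harmonic (J+1)
  have hJ1 : J ≤ Q + 1 := by
    rw [hJ]
    apply Nat.div_le_of_le_mul
    have : Q + u ≤ u * (Q + 1) := by nlinarith
    omega
  have hlogQ : 0 ≤ Real.log Q := Real.log_nonneg hQ'
  have h3 : Real.log J ≤ 1 + Real.log Q := by
    rcases Nat.eq_zero_or_pos J with h | h
    · rw [h]; simp; linarith
    · have hJ' : (0:ℝ) < J := by exact_mod_cast h
      have : (J:ℝ) ≤ 2 * Q := by
        have : (J:ℝ) ≤ Q + 1 := by exact_mod_cast hJ1
        linarith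
      have h4 := Real.log_le_log hJ' this
      rw [Real.log_mul (by norm_num) (by linarith)] at h4
      have := Real.log_two_lt_d9
      linarith
  have hJ2 : Q ≤ u * (J + 1 + 1) := by
    have := Nat.lt_mul_div_succ (Q+u-ρ) hu
    rw [← hJ] at this
    rw [mul_add u (J+1) 1]
    omega
  have h5 : Real.log Q ≤ Real.log u + Real.log ((J+1:ℕ)+1) := by
    rw [← Real.log_mul (by positivity) (by positivity)]
    apply Real.log_le_log (by linarith)
    have : (Q:ℝ) ≤ ((u * (J+1+1) : ℕ):ℝ) := by exact_mod_cast hJ2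
    push_cast at this ⊢
    exact this
  have h6 : Real.log u ≤ u - 1 := Real.log_le_sub_one_of_pos (by linarith)
  rw [abs_le]
  push_cast at *
  constructor <;> linarith

lemma main_term : ∃ S : ℝ, 0 < S ∧ ∀ (Q u ρ V0 : ℕ), ρ < u → 1 ≤ Q →
    |(∑ v ∈ Finset.range (Q+1), if V0 < v ∧ v % u = ρ then ff Q u v else 0)
      - (Q:ℝ)^2 * Real.log Q/(2*(u:ℝ)^2)| ≤ (S + V0 + u) * (Q:ℝ)^2 := by
  have hsum : Summable (fun n : ℕ => 1/(n:ℝ)^2) := Real.summable_one_div_nat_pow.mpr (by norm_num)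
  set S := ∑' n : ℕ, 1/(n:ℝ)^2 with hS
  have hS0 : 0 ≤ S := tsum_nonneg fun n => by positivity
  refine ⟨S + 10, by linarith, ?_⟩
  intro Q u ρ V0 hρ hQ
  have hu : 0 < u := by omega
  have hu' : (1:ℝ) ≤ u := by exact_mod_cast hu
  have hQ' : (1:ℝ) ≤ Q := by exact_mod_cast hQ
  set A := ∑ v ∈ (Finset.range (Q+1)).filter (fun v => v % u = ρ), 1/((u:ℝ)+v) with hA
  have hap := ap_harm Q u ρ hρ hQ
  rw [← hA] at hap
  set B := ∑ v ∈ Finset.range (Q+1), if V0 < v ∧ v % u = ρ then 1/((u:ℝ)+v) else 0 with hB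
  have hAB : |A - B| ≤ V0 + 1 := by
    rw [hA, hB, Finset.sum_filter, ← Finset.sum_sub_distrib]
    calc _ ≤ ∑ v ∈ Finset.range (Q+1), |_| := Finset.abs_sum_le_sum_abs _ _
      _ ≤ ∑ v ∈ Finset.range (Q+1), (if v ≤ V0 then (1:ℝ) else 0) := by
          apply Finset.sum_le_sum
          intro v _
          have h1 : 1/((u:ℝ)+v) ≤ 1 := by
            rw [div_le_one (by positivity)]
            have : (0:ℝ) ≤ v := by positivity
            linarith
          have h0 : 0 ≤ 1/((u:ℝ)+v) := by positivity
          by_cases hv : v ≤ V0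
          · have : ¬ (V0 < v) := by omega
            simp only [this, false_and, if_false, if_pos hv, sub_zero]
            split_ifs
            · rw [abs_of_nonneg h0]; exact h1
            · simp
          · have : (V0 < v) := by omega
            simp [this, hv]
      _ ≤ V0 + 1 := by
          rw [← Finset.sum_filter, Finset.sum_const, nsmul_eq_mul, mul_one]
          have : ((Finset.range (Q+1)).filter (fun v => v ≤ V0)).card ≤ (Finset.range (V0+1)).card := by
            apply Finset.card_le_card
            intro v hv
            simp only [Finset.mem_filter, Finset.mem_range] at hv ⊢
            omega
          rw [Finset.card_range] at this
          exact_mod_cast this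
  have herr : |(∑ v ∈ Finset.range (Q+1), if V0 < v ∧ v % u = ρ then ff Q u v else 0)
      - (Q:ℝ)^2/(2*u) * B| ≤ (4 + S) * (Q:ℝ)^2 := by
    rw [hB, Finset.mul_sum, ← Finset.sum_sub_distrib]
    calc _ ≤ ∑ v ∈ Finset.range (Q+1), |_| := Finset.abs_sum_le_sum_abs _ _
      _ ≤ ∑ v ∈ Finset.range (Q+1), (2 * (Q:ℝ) + (Q:ℝ)^2 * (1/(v:ℝ)^2)) := by
          apply Finset.sum_le_sum
          intro v _
          split_ifs with h
          · have hv : 0 < v := by omega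
            rw [ff_eq Q u v hu hv]
            have h1 := f1_main Q u v hu
            have h2 := f1_le Q u v hv
            have e : (Q:ℝ)^2/(2*u) * (1/(u+v)) = (Q:ℝ)^2/(2*u*(u+v)) := by
              rw [div_mul_div_comm, mul_one]
            rw [e]
            rw [abs_le] at h1 ⊢
            constructor <;> linarith [h1.1, h1.2, h2.1, h2.2]
          · simp; positivity
      _ = (Q+1) * (2 * (Q:ℝ)) + (Q:ℝ)^2 * ∑ v ∈ Finset.range (Q+1), (1/(v:ℝ)^2) := by
          rw [Finset.sum_add_distrib, Finset.mul_sum]; simp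
      _ ≤ _ := by
          have : ∑ v ∈ Finset.range (Q+1), (1/(v:ℝ)^2) ≤ S :=
            hsum.sum_le_tsum _ (fun i _ => by positivity)
          nlinarith
  have hm : |(Q:ℝ)^2/(2*u) * B - (Q:ℝ)^2 * Real.log Q/(2*(u:ℝ)^2)| ≤ (V0 + 3 + u) * (Q:ℝ)^2 := by
    have e : (Q:ℝ)^2/(2*u) * B - (Q:ℝ)^2 * Real.log Q/(2*(u:ℝ)^2) =
      (Q:ℝ)^2 * (-(A-B)/(2*u) + (u*A - Real.log Q)/(2*(u:ℝ)^2)) := by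
      field_simp; ring
    rw [e, abs_mul, abs_of_nonneg (by positivity : (0:ℝ) ≤ (Q:ℝ)^2), mul_comm]
    apply mul_le_mul_of_nonneg_right _ (by positivity)
    have q1 : |-(A-B)/(2*u)| ≤ V0 + 1 := by
      rw [abs_div, abs_neg]
      refine (div_le_self (abs_nonneg _) ?_).trans hAB
      rw [abs_of_nonneg (by positivity)]; linarith
    have q2 : |(u*A - Real.log Q)/(2*(u:ℝ)^2)| ≤ 2 + (u:ℝ) := by
      rw [abs_div]
      refine (div_le_self (abs_nonneg _) ?_).trans hap
      rw [abs_of_nonneg (by positivity)]; nlinarith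
    refine (abs_add_le _ _).trans ?_
    linarith
  have := abs_add_le ((∑ v ∈ Finset.range (Q+1), if V0 < v ∧ v % u = ρ then ff Q u v else 0)
      - (Q:ℝ)^2/(2*u) * B) ((Q:ℝ)^2/(2*u) * B - (Q:ℝ)^2 * Real.log Q/(2*(u:ℝ)^2))
  rw [sub_add_sub_cancel] at this
  nlinarith

lemma comb4 {T a b c x y k1 k2 k3 k4 : ℝ} (h1 : |T - (a + b - c)| ≤ k1) (h2 : |b| ≤ k2)
    (h3 : |a - x| ≤ k3) (h4 : |c - y| ≤ k4) : |T - (x - y)| ≤ k1 + k2 + k3 + k4 := by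
  rw [abs_le] at *
  constructor <;> linarith [h1.1, h1.2, h2.1, h2.2, h3.1, h3.2, h4.1, h4.2]

theorem TT_main (v0 w : ℕ) (hv0 : 0 < v0) (hw : v0 < w) (hcop : Nat.Coprime v0 w) :
    ∃ C : ℝ, 0 < C ∧ ∀ Q : ℕ, 1 ≤ Q →
      |TT v0 w Q - (1 - 1/(w:ℝ)^2) * (Real.log Q * ((Q:ℝ)^2/2))| ≤ C * (Q:ℝ)^2 := by
  obtain ⟨S, hS, hm⟩ := main_term
  obtain ⟨C3, hC3, h3⟩ := S3_bound
  obtain ⟨ρ, hρ, hρ1⟩ : ∃ ρ, ρ < w ∧ ∀ v, (v * v0) % w = 1 ↔ v % w = ρ := by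
    obtain ⟨m, hm1, hm2⟩ := Nat.exists_mul_mod_eq_one_of_coprime hcop (by omega)
    refine ⟨m % w, Nat.mod_lt _ (by omega), ?_⟩
    intro v
    have hmm : (m * v0) % w = 1 := by rw [mul_comm]; exact hm2
    constructor
    · intro h
      have : v * v0 ≡ m * v0 [MOD w] := by unfold Nat.ModEq; rw [h, hmm]
      exact Nat.ModEq.cancel_right_of_coprime hcop.symm this
    · intro h
      have : v ≡ m [MOD w] := h
      have h2 := this.mul_right v0
      unfold Nat.ModEq at h2
      rw [h2, hmm]
  refine ⟨((w:ℝ)^2+2)^4 + C3 + (S + w + 1) + (S + w + w), by positivity, ?_⟩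
  intro Q hQ
  have hT := TT_eq4 v0 w Q hv0 hw hcop
  have hA := h3 v0 w Q (by omega)
  have hB := hm Q 1 0 (w-1) (by norm_num) hQ
  have hD := hm Q w ρ w hρ hQ
  have e1 : (∑ v ∈ Finset.range (Q+1), if w - 1 < v ∧ v % 1 = 0 then ff Q 1 v else 0) =
      ∑ v ∈ Finset.range (Q+1), if w ≤ v then ff Q 1 v else 0 := by
    apply Finset.sum_congr rfl
    intro v _
    have : (w - 1 < v ∧ v % 1 = 0) ↔ w ≤ v := by omega
    simp only [this]
  have e2 : (∑ v ∈ Finset.range (Q+1), if w < v ∧ v % w = ρ then ff Q w v else 0) =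
      ∑ v ∈ Finset.range (Q+1), if w < v ∧ (v*v0) % w = 1 then ff Q w v else 0 := by
    simp only [hρ1]
  rw [e1] at hB
  rw [e2] at hD
  have hw1 : ((w-1:ℕ):ℝ) ≤ w := by exact_mod_cast Nat.sub_le _ _
  have hw0 : (0:ℝ) < w := by exact_mod_cast (by omega : 0 < w)
  have hQ2 : (0:ℝ) ≤ (Q:ℝ)^2 := by positivity
  have hB2 : (S + ((w-1:ℕ):ℝ) + ((1:ℕ):ℝ)) * (Q:ℝ)^2 ≤ (S + w + 1) * (Q:ℝ)^2 := by
    apply mul_le_mul_of_nonneg_right _ hQ2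
    push_cast; linarith
  have e3 : (1 - 1/(w:ℝ)^2) * (Real.log Q * ((Q:ℝ)^2/2)) =
      (Q:ℝ)^2 * Real.log Q/(2*((1:ℕ):ℝ)^2) - (Q:ℝ)^2 * Real.log Q/(2*(w:ℝ)^2) := by
    push_cast
    field_simp
  rw [e3]
  refine (comb4 hT hA (hB.trans hB2) hD).trans (le_of_eq ?_)
  ring

end DSA


namespace DSA

lemma moeb_ind (Q a b : ℕ) (ha : 0 < a) (haQ : a ≤ Q) :
    (if Nat.Coprime a b then (1:ℝ) else 0) =
      ∑ d ∈ Finset.Icc 1 Q, if d ∣ a ∧ d ∣ b then (ArithmeticFunction.moebius d : ℝ) else 0 := by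
  have h := ArithmeticFunction.coe_moebius_mul_coe_zeta (R := ℝ)
  have h2 := congrArg (fun f => f (Nat.gcd a b)) h
  simp only [ArithmeticFunction.coe_mul_zeta_apply, ArithmeticFunction.one_apply] at h2
  rw [← Finset.sum_filter]
  have hg : 0 < Nat.gcd a b := Nat.gcd_pos_of_pos_left _ ha
  have e : (Finset.Icc 1 Q).filter (fun d => d ∣ a ∧ d ∣ b) = (Nat.gcd a b).divisors := by
    ext d
    simp only [Finset.mem_filter, Finset.mem_Icc, Nat.mem_divisors, Nat.dvd_gcd_iff]
    constructor
    · rintro ⟨_, h⟩; exact ⟨h, by omega⟩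
    · rintro ⟨h, _⟩
      have := Nat.le_of_dvd ha h.1
      have := Nat.pos_of_dvd_of_pos h.1 ha
      exact ⟨⟨by omega, by omega⟩, h⟩
  rw [e]
  simp only [ArithmeticFunction.intCoe_apply] at h2
  rw [h2]

lemma sum_mult (Q d : ℕ) (hd : 0 < d) (φ : ℕ → ℝ) :
    ∑ a ∈ Finset.Icc 1 Q, (if d ∣ a then φ a else 0) = ∑ a ∈ Finset.Icc 1 (Q/d), φ (d*a) := by
  rw [← Finset.sum_filter]
  have : (Finset.Icc 1 Q).filter (fun a => d ∣ a) = (Finset.Icc 1 (Q/d)).image (fun a => d*a) := by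
    ext a
    simp only [Finset.mem_filter, Finset.mem_Icc, Finset.mem_image]
    constructor
    · rintro ⟨h1, k, rfl⟩
      refine ⟨k, ⟨?_, ?_⟩, rfl⟩
      · rcases Nat.eq_zero_or_pos k with h | h
        · subst h; omega
        · exact h
      · rw [Nat.le_div_iff_mul_le hd, mul_comm]; exact h1.2
    · rintro ⟨k, ⟨h1, h2⟩, rfl⟩
      rw [Nat.le_div_iff_mul_le hd, mul_comm] at h2
      have : 0 < d * k := by positivity
      exact ⟨⟨this, h2⟩, dvd_mul_right _ _⟩
  rw [this, Finset.sum_image]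
  intro a _ b _ h
  exact Nat.eq_of_mul_eq_mul_left hd h

lemma moeb_sum (Q : ℕ) (h : ℕ → ℕ → ℝ)
    (hh : ∀ d b a, 0 < d → 0 < b → 0 < a → h (d*b) (d*a) = h b a) :
    ∑ b ∈ Finset.Icc 1 Q, ∑ a ∈ Finset.Icc 1 Q, (if Nat.Coprime a b then h b a else 0) =
    ∑ d ∈ Finset.Icc 1 Q, (ArithmeticFunction.moebius d : ℝ) *
      ∑ b ∈ Finset.Icc 1 (Q/d), ∑ a ∈ Finset.Icc 1 (Q/d), h b a := by
  have e1 : ∀ b ∈ Finset.Icc 1 Q, ∀ a ∈ Finset.Icc 1 Q, (if Nat.Coprime a b then h b a else 0) =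
      ∑ d ∈ Finset.Icc 1 Q, (ArithmeticFunction.moebius d : ℝ) *
        (if d ∣ b then (if d ∣ a then h b a else 0) else 0) := by
    intro b hb a ha
    simp only [Finset.mem_Icc] at ha
    have := moeb_ind Q a b (by omega) (by omega)
    calc _ = (if Nat.Coprime a b then (1:ℝ) else 0) * h b a := by split_ifs <;> simp
      _ = _ := by
        rw [this, Finset.sum_mul]
        apply Finset.sum_congr rfl
        intro d _
        by_cases h1 : d ∣ a <;> by_cases h2 : d ∣ b <;> simp [h1, h2]
  rw [Finset.sum_congr rfl fun b hb => Finset.sum_congr rfl fun a ha => e1 b hb a ha]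
  rw [Finset.sum_congr rfl (fun b _ => Finset.sum_comm), Finset.sum_comm]
  apply Finset.sum_congr rfl
  intro d hd
  simp only [Finset.mem_Icc] at hd
  have hd0 : 0 < d := by omega
  simp_rw [← Finset.mul_sum]
  congr 1
  have e2 : ∀ b, ∑ a ∈ Finset.Icc 1 Q, (if d ∣ b then (if d ∣ a then h b a else 0) else 0) =
      if d ∣ b then ∑ a ∈ Finset.Icc 1 (Q/d), h b (d*a) else 0 := by
    intro b
    split_ifs
    · exact sum_mult Q d hd0 (h b)
    · simp
  simp_rw [e2]
  rw [sum_mult Q d hd0 (fun b => ∑ a ∈ Finset.Icc 1 (Q/d), h b (d*a))]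
  apply Finset.sum_congr rfl
  intro b hb
  apply Finset.sum_congr rfl
  intro a ha
  simp only [Finset.mem_Icc] at ha hb
  exact hh d b a hd0 (by omega) (by omega)

lemma count_lep (y : ℕ) : ∑ b ∈ Finset.Icc 1 y, ∑ a ∈ Finset.Icc 1 y, (if a ≤ b then (1:ℝ) else 0) =
    (y:ℝ) * (y+1)/2 := by
  have : ∀ b ∈ Finset.Icc 1 y, ∑ a ∈ Finset.Icc 1 y, (if a ≤ b then (1:ℝ) else 0) = b := by
    intro b hb
    simp only [Finset.mem_Icc] at hb
    rw [← Finset.sum_filter, Finset.sum_const, nsmul_eq_mul, mul_one]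
    have : (Finset.Icc 1 y).filter (fun a => a ≤ b) = Finset.Icc 1 b := by
      ext a; simp only [Finset.mem_filter, Finset.mem_Icc]; omega
    rw [this]; simp
  rw [Finset.sum_congr rfl this]
  clear this
  induction y with
  | zero => simp
  | succ m ih => rw [Finset.sum_Icc_succ_top (by omega), ih]; push_cast; ring

lemma count_ltp (y : ℕ) : ∑ b ∈ Finset.Icc 1 y, ∑ a ∈ Finset.Icc 1 y, (if a < b then (1:ℝ) else 0) =
    (y:ℝ) * (y-1)/2 := by
  have : ∀ b ∈ Finset.Icc 1 y, ∑ a ∈ Finset.Icc 1 y, (if a < b then (1:ℝ) else 0) = (b:ℝ) - 1 := by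
    intro b hb
    simp only [Finset.mem_Icc] at hb
    rw [← Finset.sum_filter, Finset.sum_const, nsmul_eq_mul, mul_one]
    have : (Finset.Icc 1 y).filter (fun a => a < b) = Finset.Icc 1 (b-1) := by
      ext a; simp only [Finset.mem_filter, Finset.mem_Icc]; omega
    rw [this]; simp [hb.1]
  rw [Finset.sum_congr rfl this]
  clear this
  induction y with
  | zero => simp
  | succ m ih => rw [Finset.sum_Icc_succ_top (by omega), ih]; push_cast; ring

lemma moeb_abs (d : ℕ) : |(ArithmeticFunction.moebius d : ℝ)| ≤ 1 := by
  exact_mod_cast ArithmeticFunction.abs_moebius_le_one (n := d)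

lemma inv_sq_sum (Q : ℕ) (hQ : 2 ≤ Q) : ∑ d ∈ Finset.Icc 2 Q, 1/(d:ℝ)^2 ≤ 3/4 - 1/(Q:ℝ) + 0 ∨ Q ≤ 3 := by
  rcases Nat.lt_or_ge Q 4 with h | h
  · right; omega
  left
  induction Q, h using Nat.le_induction with
  | base =>
    rw [show Finset.Icc 2 4 = {2,3,4} by decide]; norm_num
  | succ n hn ih =>
    have ih := ih (by omega)
    rw [Finset.sum_Icc_succ_top (by omega)]
    have hn' : (4:ℝ) ≤ n := by exact_mod_cast hn
    have : 1/(((n+1:ℕ):ℝ))^2 ≤ 1/(n:ℝ) - 1/((n+1:ℕ):ℝ) := by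
      push_cast
      rw [div_sub_div _ _ (by positivity) (by positivity), div_le_div_iff₀ (by positivity) (by positivity)]
      nlinarith
    linarith

lemma inv_sq_sum2 (Q : ℕ) (hQ : 2 ≤ Q) : ∑ d ∈ Finset.Icc 2 Q, 1/(d:ℝ)^2 ≤ 3/4 := by
  rcases inv_sq_sum Q hQ with h | h
  · have : 0 ≤ 1/(Q:ℝ) := by positivity
    linarith
  · interval_cases Q
    · simp; norm_num
    · rw [show Finset.Icc 2 3 = {2,3} by decide]; norm_num

lemma cop_lower (Q : ℕ) (hQ : 2 ≤ Q) : (Q:ℝ)^2/16 ≤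
    ∑ b ∈ Finset.Icc 1 Q, ∑ a ∈ Finset.Icc 1 Q,
      (if Nat.Coprime a b then (if a ≤ b then (1:ℝ) else 0) else 0) := by
  have hQ' : (2:ℝ) ≤ Q := by exact_mod_cast hQ
  have h1 := moeb_sum Q (fun b a => if a < b then (1:ℝ) else 0) (by
    intro d b a hd _ _
    simp only [Nat.mul_lt_mul_left hd])
  simp_rw [count_ltp] at h1
  calc (Q:ℝ)^2/16 ≤ (Q:ℝ)*(Q-1)/2 * (1 - 3/4) := by nlinarith
    _ ≤ (Q:ℝ)*(Q-1)/2 * (1 - ∑ d ∈ Finset.Icc 2 Q, 1/(d:ℝ)^2) := by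
        apply mul_le_mul_of_nonneg_left
        · linarith [inv_sq_sum2 Q hQ]
        · have : (0:ℝ) ≤ Q - 1 := by linarith
          positivity
    _ ≤ ∑ d ∈ Finset.Icc 1 Q, (ArithmeticFunction.moebius d : ℝ) *
          (((Q/d:ℕ):ℝ) * (((Q/d:ℕ):ℝ) - 1)/2) := by
        rw [← Finset.add_sum_Ioc_eq_sum_Icc (by omega : 1 ≤ Q)]
        have : Finset.Ioc 1 Q = Finset.Icc 2 Q := by
          ext d; simp only [Finset.mem_Ioc, Finset.mem_Icc]; omega
        rw [this, mul_sub, mul_one, sub_eq_add_neg, Finset.mul_sum, ← Finset.sum_neg_distrib]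
        apply add_le_add
        · simp
        · apply Finset.sum_le_sum
          intro d hd
          simp only [Finset.mem_Icc] at hd
          have hd' : (2:ℝ) ≤ d := by exact_mod_cast hd.1
          have hm := abs_le.mp (moeb_abs d)
          set y : ℝ := ((Q/d:ℕ):ℝ) with hy
          have hy1 : 1 ≤ y := by
            have : 1 ≤ Q/d := (Nat.one_le_div_iff (by omega)).mpr hd.2
            rw [hy]; exact_mod_cast this
          have hy2 : y ≤ Q/d := Nat.cast_div_le
          have hy3 : y * d ≤ Q := by rwa [le_div_iff₀ (by linarith)] at hy2
          have hyy : 0 ≤ y * (y-1)/2 := by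
            have : 0 ≤ y - 1 := by linarith
            positivity
          have hfin : y * (y-1)/2 ≤ (Q:ℝ)*(Q-1)/2 * (1/(d:ℝ)^2) := by
            rw [mul_one_div, div_div, div_le_div_iff₀ (by norm_num) (by positivity)]
            have a1 : y * d * (y * d - d) ≤ Q * (Q - 1) := by
              apply mul_le_mul hy3 (by linarith) _ (by linarith)
              nlinarith
            nlinarith
          nlinarith [hm.1]
    _ = _ := h1.symm
    _ ≤ _ := by
        apply Finset.sum_le_sum
        intro b _
        apply Finset.sum_le_sum
        intro a _
        split_ifs <;> first | omega | norm_num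

end DSA


namespace DSA

lemma bracket (v0 w : ℕ) (C : ℝ) (hC : 0 < C) (k : ℝ) (hk0 : 0 ≤ k) (hk1 : k ≤ 1)
    (hT : ∀ Q : ℕ, 1 ≤ Q → |TT v0 w Q - k * (Real.log Q * ((Q:ℝ)^2/2))| ≤ C * (Q:ℝ)^2)
    (Q d : ℕ) (hd : 1 ≤ d) (hdQ : d ≤ Q) :
    |TT v0 w (Q/d) - k * Real.log Q * (((Q/d:ℕ):ℝ) * (((Q/d:ℕ):ℝ) + 1)/2)| ≤
      (C + 5) * (Q:ℝ)^2 * (d:ℝ)^(-3/2:ℝ) := by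
  have hd' : (1:ℝ) ≤ d := by exact_mod_cast hd
  have hd0 : (0:ℝ) < d := by linarith
  have hQ' : (1:ℝ) ≤ Q := by exact_mod_cast hd.trans hdQ
  have hy0 : 1 ≤ Q/d := (Nat.one_le_div_iff (by omega)).mpr hdQ
  have h1 := hT (Q/d) hy0
  have hlt : (Q:ℝ) < d * ((Q/d:ℕ):ℝ) + d := by
    have := Nat.lt_mul_div_succ Q hd
    have h2 : (Q:ℝ) < ((d * (Q/d+1) : ℕ):ℝ) := by exact_mod_cast this
    push_cast at h2 ⊢
    linarith
  set T := TT v0 w (Q/d)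
  have hy2 : ((Q/d:ℕ):ℝ) ≤ Q/d := Nat.cast_div_le
  set y : ℝ := ((Q/d:ℕ):ℝ) with hy
  have hy1 : 1 ≤ y := by rw [hy]; exact_mod_cast hy0
  set L := Real.log (2*d) with hL
  have hL0 : 0 ≤ L := Real.log_nonneg (by linarith)
  have hly : Real.log y ≤ y := (Real.log_le_sub_one_of_pos (by linarith)).trans (by linarith)
  have hly0 : 0 ≤ Real.log y := Real.log_nonneg hy1
  have hyQ : Real.log y ≤ Real.log Q := by
    apply Real.log_le_log (by linarith)
    exact hy2.trans (div_le_self (by linarith) hd')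
  have hQy : Real.log Q ≤ Real.log y + L := by
    rw [hL, ← Real.log_mul (by linarith) (by linarith)]
    apply Real.log_le_log (by linarith)
    nlinarith
  have hmid0 : 0 ≤ Real.log Q * (y * (y+1)/2) - Real.log y * (y^2/2) := by nlinarith
  have hmid : Real.log Q * (y * (y+1)/2) - Real.log y * (y^2/2) ≤ y^2 * (1 + L) := by
    have a1 : Real.log Q * (y * (y+1)/2) ≤ (Real.log y + L) * (y * (y+1)/2) :=
      mul_le_mul_of_nonneg_right hQy (by positivity)
    have a2 : y ≤ y^2 := by nlinarith
    have a3 : L * y ≤ L * y^2 := mul_le_mul_of_nonneg_left a2 hL0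
    have a4 : Real.log y * y ≤ y * y := mul_le_mul_of_nonneg_right hly (by linarith)
    nlinarith
  have hL1 : L ≤ 4 * (d:ℝ)^(1/2:ℝ) := by
    have := Real.log_le_rpow_div (x := 2*d) (by positivity) (ε := 1/2) (by norm_num)
    rw [Real.mul_rpow (by norm_num) hd0.le] at this
    have h2 : (2:ℝ)^(1/2:ℝ) ≤ 2 := by
      calc (2:ℝ)^(1/2:ℝ) ≤ 2^(1:ℝ) := Real.rpow_le_rpow_of_exponent_le (by norm_num) (by norm_num)
        _ = 2 := by norm_num
    have h3 : 0 ≤ (d:ℝ)^(1/2:ℝ) := by positivity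
    rw [← hL] at this
    have : L ≤ (2:ℝ)^(1/2:ℝ) * (d:ℝ)^(1/2:ℝ) * 2 := by
      refine this.trans (le_of_eq ?_)
      ring
    nlinarith
  have hone : 1 ≤ (d:ℝ)^(1/2:ℝ) := Real.one_le_rpow hd' (by norm_num)
  have htot : |T - k * Real.log Q * (y * (y+1)/2)| ≤ y^2 * (C + 1 + L) := by
    have e : T - k * Real.log Q * (y * (y+1)/2) = (T - k * (Real.log y * (y^2/2))) -
      k * (Real.log Q * (y * (y+1)/2) - Real.log y * (y^2/2)) := by ring
    rw [e]
    refine (abs_sub _ _).trans ?_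
    have : |k * (Real.log Q * (y * (y+1)/2) - Real.log y * (y^2/2))| ≤ y^2 * (1+L) := by
      rw [abs_of_nonneg (mul_nonneg hk0 hmid0)]
      refine le_trans ?_ hmid
      exact mul_le_of_le_one_left hmid0 hk1
    linarith
  refine htot.trans ?_
  have hpow : (d:ℝ)^(-3/2:ℝ) = (d:ℝ)^(1/2:ℝ) / (d:ℝ)^2 := by
    rw [← Real.rpow_natCast, ← Real.rpow_sub hd0]; norm_num
  calc y^2 * (C + 1 + L) ≤ ((Q:ℝ)/d)^2 * ((C + 5) * (d:ℝ)^(1/2:ℝ)) := by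
        apply mul_le_mul _ _ (by positivity) (by positivity)
        · exact pow_le_pow_left₀ (by linarith) hy2 2
        · nlinarith
    _ = _ := by rw [hpow]; field_simp

lemma cop_main (v0 w : ℕ) (hv0 : 0 < v0) (hw : v0 < w) (hcop : Nat.Coprime v0 w) :
    ∃ K : ℝ, 0 < K ∧ ∀ Q : ℕ, 2 ≤ Q →
      |∑ b ∈ Finset.Icc 1 Q, ∑ a ∈ Finset.Icc 1 Q, (if Nat.Coprime a b then
        ((if w * a < v0 * b then (gg b a : ℝ) else 0) -
          (1 - 1/(w:ℝ)^2) * Real.log Q * (if a ≤ b then 1 else 0)) else 0)| ≤ K * (Q:ℝ)^2 := by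
  obtain ⟨C, hC, hT⟩ := TT_main v0 w hv0 hw hcop
  have hw1 : (1:ℝ) ≤ w := by exact_mod_cast (by omega : 1 ≤ w)
  set k := 1 - 1/(w:ℝ)^2 with hk
  have hk0 : 0 ≤ k := by
    have : 1/(w:ℝ)^2 ≤ 1 := by rw [div_le_one (by positivity)]; nlinarith
    linarith
  have hk1 : k ≤ 1 := by
    have : 0 ≤ 1/(w:ℝ)^2 := by positivity
    linarith
  have hsum : Summable (fun n : ℕ => (n:ℝ)^(-3/2:ℝ)) := Real.summable_nat_rpow.mpr (by norm_num)
  set S := ∑' n : ℕ, (n:ℝ)^(-3/2:ℝ) with hS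
  have hS0 : 0 ≤ S := tsum_nonneg fun n => by positivity
  refine ⟨(C+5) * S + 1, by positivity, ?_⟩
  intro Q hQ
  rw [moeb_sum Q (fun b a => (if w * a < v0 * b then (gg b a : ℝ) else 0) -
          k * Real.log Q * (if a ≤ b then 1 else 0))]
  · calc _ ≤ ∑ d ∈ Finset.Icc 1 Q, |_| := Finset.abs_sum_le_sum_abs _ _
      _ ≤ ∑ d ∈ Finset.Icc 1 Q, (C + 5) * (Q:ℝ)^2 * (d:ℝ)^(-3/2:ℝ) := by
          apply Finset.sum_le_sum
          intro d hd
          simp only [Finset.mem_Icc] at hd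
          rw [abs_mul]
          have e : ∑ b ∈ Finset.Icc 1 (Q/d), ∑ a ∈ Finset.Icc 1 (Q/d),
              ((if w * a < v0 * b then (gg b a : ℝ) else 0) -
                k * Real.log Q * (if a ≤ b then 1 else 0)) =
              TT v0 w (Q/d) - k * Real.log Q * (((Q/d:ℕ):ℝ) * (((Q/d:ℕ):ℝ) + 1)/2) := by
            simp_rw [Finset.sum_sub_distrib, ← Finset.mul_sum]
            rw [count_lep]
            rfl
          rw [e]
          have hb := bracket v0 w C hC k hk0 hk1 hT Q d hd.1 hd.2
          refine le_trans ?_ hb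
          exact mul_le_of_le_one_left (abs_nonneg _) (moeb_abs d)
      _ = (C + 5) * (Q:ℝ)^2 * ∑ d ∈ Finset.Icc 1 Q, (d:ℝ)^(-3/2:ℝ) := by rw [Finset.mul_sum]
      _ ≤ (C + 5) * (Q:ℝ)^2 * S := by
          apply mul_le_mul_of_nonneg_left _ (by positivity)
          exact hsum.sum_le_tsum _ (fun i _ => by positivity)
      _ ≤ _ := by nlinarith [sq_nonneg (Q:ℝ)]
  · intro d b a hd hb ha
    have c1 : w * (d * a) < v0 * (d * b) ↔ w * a < v0 * b := by
      rw [Nat.mul_left_comm w, Nat.mul_left_comm v0, Nat.mul_lt_mul_left hd]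
    simp only [c1, gg_mul d hd _ b a le_rfl ha hb, Nat.mul_le_mul_left_iff hd]

lemma farey_sum (Q : ℕ) (hQ : 1 ≤ Q) (φ : ℚ → ℝ) :
    ∑ x ∈ farey Q, φ x = φ 0 + ∑ b ∈ Finset.Icc 1 Q, ∑ a ∈ Finset.Icc 1 Q,
      (if Nat.Coprime a b then (if a ≤ b then φ ((a:ℚ)/(b:ℚ)) else 0) else 0) := by
  set P := ((Finset.Icc 1 Q) ×ˢ (Finset.Icc 1 Q)).filter
    (fun p : ℕ × ℕ => Nat.Coprime p.2 p.1 ∧ p.2 ≤ p.1) with hP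
  have hPm : ∀ p : ℕ × ℕ, p ∈ P ↔ ((1 ≤ p.1 ∧ p.1 ≤ Q) ∧ (1 ≤ p.2 ∧ p.2 ≤ Q)) ∧
      Nat.Coprime p.2 p.1 ∧ p.2 ≤ p.1 := by
    intro p; rw [hP]; simp only [Finset.mem_filter, Finset.mem_product, Finset.mem_Icc]
  have e : farey Q = insert 0 (P.image (fun p => ((p.2:ℚ)/(p.1:ℚ)))) := by
    ext x
    unfold farey
    simp only [Finset.mem_biUnion, Finset.mem_image, Finset.mem_insert, Finset.mem_Icc]
    constructor
    · rintro ⟨b, hb, a, ha, rfl⟩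
      rcases Nat.eq_zero_or_pos a with h | h
      · left; simp [h]
      · right
        obtain ⟨g, a', b', hg, hc, rfl, rfl⟩ := Nat.exists_coprime' (m := a) (n := b) (Nat.gcd_pos_of_pos_left _ h)
        have ha' : 0 < a' := Nat.pos_of_mul_pos_right h
        have hb' : 0 < b' := by
          rcases Nat.eq_zero_or_pos b' with h0 | h0
          · subst h0; omega
          · exact h0
        have hbQ : b' ≤ Q := le_trans (Nat.le_mul_of_pos_right _ hg) hb.2
        have hab : a' ≤ b' := Nat.le_of_mul_le_mul_right ha.2 hg
        refine ⟨(b', a'), (hPm _).mpr ⟨⟨⟨hb', hbQ⟩, ⟨ha', by omega⟩⟩, hc, hab⟩, ?_⟩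
        have : (g:ℚ) ≠ 0 := by exact_mod_cast hg.ne'
        push_cast
        rw [mul_div_mul_right _ _ this]
    · rintro (rfl | ⟨p, hp, rfl⟩)
      · exact ⟨1, ⟨le_rfl, hQ⟩, 0, ⟨le_rfl, by omega⟩, by simp⟩
      · rw [hPm] at hp
        exact ⟨p.1, hp.1.1, p.2, ⟨by omega, hp.2.2⟩, rfl⟩
  rw [e, Finset.sum_insert, Finset.sum_image]
  · congr 1
    rw [hP, Finset.sum_filter, Finset.sum_product]
    apply Finset.sum_congr rfl
    intro b _
    apply Finset.sum_congr rfl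
    intro a _
    by_cases h1 : Nat.Coprime a b <;> by_cases h2 : a ≤ b <;> simp [h1, h2]
  · rintro ⟨b, a⟩ h1 ⟨b', a'⟩ h2 h
    rw [Finset.mem_coe, hPm] at h1 h2
    simp only at h h1 h2
    have hn := congrArg Rat.num h
    have hd := congrArg Rat.den h
    have n1 := Rat.num_div_eq_of_coprime (a := a) (b := b) (by omega) (by simpa using h1.2.1)
    have n2 := Rat.num_div_eq_of_coprime (a := a') (b := b') (by omega) (by simpa using h2.2.1)
    have d1 := Rat.den_div_eq_of_coprime (a := a) (b := b) (by omega) (by simpa using h1.2.1)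
    have d2 := Rat.den_div_eq_of_coprime (a := a') (b := b') (by omega) (by simpa using h2.2.1)
    push_cast at n1 n2 d1 d2
    rw [n1, n2] at hn
    rw [hd] at d1
    have : b = b' := by
      have := d1.symm.trans d2
      exact_mod_cast this
    have : a = a' := by exact_mod_cast hn
    simp [*]
  · simp only [Finset.mem_image, not_exists, not_and]
    intro p hp
    rw [hPm] at hp
    have h1 : (0:ℚ) < p.2 := by exact_mod_cast hp.1.2.1
    have h2 : (0:ℚ) < p.1 := by exact_mod_cast hp.1.1.1
    positivity

lemma sQ_zero : sQ 0 = 0 := by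
  unfold sQ dedekindSum
  simp [saw]

theorem final (α : ℚ) (hα0 : 0 < α) (hα1 : α ≤ 1/2) :
    ∃ C : ℝ, 0 < C ∧ ∀ Q : ℕ, 2 ≤ Q →
      |(1 / ((farey Q).card : ℝ)) * (∑ x ∈ (farey Q).filter (fun x => x < α), sQ x)
        - 1/12 * (1 - 1/(α.den : ℝ)^2) * Real.log Q| ≤ C := by
  set w := α.den with hw
  set v0 := α.num.toNat with hv
  have hnum : 0 < α.num := Rat.num_pos.mpr hα0
  have hv0 : 0 < v0 := by omega
  have hvz : (v0:ℤ) = α.num := by omega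
  have hw0 : 0 < w := α.den_pos
  have hα : α = (v0:ℚ)/(w:ℚ) := by
    have := Rat.num_div_den α
    rw [← hvz] at this
    rw [← this]
    simp [hw]
  have hwq : (0:ℚ) < w := by exact_mod_cast hw0
  have hvw : v0 < w := by
    rw [hα, div_le_iff₀ hwq] at hα1
    have : (v0:ℚ) < w := by linarith
    exact_mod_cast this
  have hcop : Nat.Coprime v0 w := by
    have := α.reduced
    have e : α.num.natAbs = v0 := by omega
    rwa [e] at this
  obtain ⟨K, hK, hmain⟩ := cop_main v0 w hv0 hvw hcop
  have hw1 : (1:ℝ) ≤ w := by exact_mod_cast hw0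
  set k := 1 - 1/(w:ℝ)^2 with hk
  have hk0 : 0 ≤ k := by
    have : 1/(w:ℝ)^2 ≤ 1 := by rw [div_le_one (by positivity)]; nlinarith
    linarith
  have hk1 : k ≤ 1 := by
    have : 0 ≤ 1/(w:ℝ)^2 := by positivity
    linarith
  refine ⟨2*(K+4), by positivity, ?_⟩
  intro Q hQ
  have hQ' : (2:ℝ) ≤ Q := by exact_mod_cast hQ
  have hm := hmain Q hQ
  set N := ∑ b ∈ Finset.Icc 1 Q, ∑ a ∈ Finset.Icc 1 Q,
      (if Nat.Coprime a b then (if a ≤ b then (1:ℝ) else 0) else 0) with hN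
  have hNlow : (Q:ℝ)^2/16 ≤ N := cop_lower Q hQ
  have hNup : N ≤ (Q:ℝ)^2 := by
    calc N ≤ ∑ b ∈ Finset.Icc 1 Q, ∑ a ∈ Finset.Icc 1 Q, (1:ℝ) := by
          apply Finset.sum_le_sum
          intro b _
          apply Finset.sum_le_sum
          intro a _
          split_ifs <;> norm_num
      _ = _ := by simp; ring
  have hcard : ((farey Q).card : ℝ) = 1 + N := by
    have := farey_sum Q (by omega) (fun _ => (1:ℝ))
    rw [Finset.sum_const, nsmul_eq_mul, mul_one] at this
    rw [this]
  have hs := farey_sum Q (by omega) (fun x => if x < α then sQ x else 0)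
  rw [Finset.sum_filter, hs]
  simp only [hα0, if_true, sQ_zero, zero_add]
  set A := ∑ b ∈ Finset.Icc 1 Q, ∑ a ∈ Finset.Icc 1 Q, (if Nat.Coprime a b then (if a ≤ b then
    (if (a:ℚ)/(b:ℚ) < α then sQ ((a:ℚ)/(b:ℚ)) else 0) else 0) else 0) with hA
  set G := ∑ b ∈ Finset.Icc 1 Q, ∑ a ∈ Finset.Icc 1 Q, (if Nat.Coprime a b then
        (if w * a < v0 * b then (gg b a : ℝ) else 0) else 0) with hG
  have hGm : |G - k * Real.log Q * N| ≤ K * (Q:ℝ)^2 := by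
    convert hm using 2
    rw [hG, hN, Finset.mul_sum, ← Finset.sum_sub_distrib]
    apply Finset.sum_congr rfl
    intro b _
    rw [Finset.mul_sum, ← Finset.sum_sub_distrib]
    apply Finset.sum_congr rfl
    intro a _
    by_cases h : Nat.Coprime a b
    · simp only [if_pos h]
    · simp only [if_neg h]; ring
  have hAG : |12 * A - G| ≤ 3 * N := by
    rw [hA, hG, hN, Finset.mul_sum, ← Finset.sum_sub_distrib, Finset.mul_sum]
    refine (Finset.abs_sum_le_sum_abs _ _).trans ?_
    apply Finset.sum_le_sum
    intro b hb
    rw [Finset.mul_sum, ← Finset.sum_sub_distrib, Finset.mul_sum]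
    refine (Finset.abs_sum_le_sum_abs _ _).trans ?_
    apply Finset.sum_le_sum
    intro a ha
    simp only [Finset.mem_Icc] at ha hb
    by_cases h : Nat.Coprime a b
    · simp only [if_pos h]
      have hbq : (0:ℚ) < b := by exact_mod_cast (by omega : 0 < b)
      have hc : (a:ℚ)/(b:ℚ) < α ↔ w * a < v0 * b := by
        rw [hα, div_lt_div_iff₀ hbq hwq]
        rw [mul_comm (a:ℚ)]
        exact_mod_cast Iff.rfl
      simp only [hc]
      by_cases h1 : w * a < v0 * b
      · have hab : a ≤ b := by
          by_contra hc2
          push Not at hc2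
          have := Nat.mul_le_mul hvw.le hc2.le
          omega
        simp only [h1, hab, if_true]
        have n1 := Rat.num_div_eq_of_coprime (a := a) (b := b) (by omega) (by simpa using h)
        have d1 := Rat.den_div_eq_of_coprime (a := a) (b := b) (by omega) (by simpa using h)
        push_cast at n1 d1
        unfold sQ
        rw [n1, d1, mul_one]
        exact ded_gg_bound b a (by omega) hab h
      · simp only [h1, if_false, ite_self]
        norm_num
        split_ifs <;> norm_num
    · simp [h]
  have hlog : Real.log Q ≤ Q := (Real.log_le_sub_one_of_pos (by linarith)).trans (by linarith)
  have hlog0 : 0 ≤ Real.log Q := Real.log_nonneg (by linarith)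
  have hkl : k * Real.log Q ≤ (Q:ℝ)^2 := by
    have : k * Real.log Q ≤ Real.log Q := mul_le_of_le_one_left hlog0 hk1
    nlinarith
  have hkl0 : 0 ≤ k * Real.log Q := by positivity
  have htot : |12 * A - k * Real.log Q * (1 + N)| ≤ (K+4) * (Q:ℝ)^2 := by
    rw [abs_le] at hGm hAG ⊢
    constructor <;> nlinarith [hGm.1, hGm.2, hAG.1, hAG.2]
  rw [hcard]
  have hN1 : 0 < 1 + N := by positivity
  have e : 1/(1+N) * A - 1/12 * k * Real.log Q = (12 * A - k * Real.log Q * (1+N)) / (12 * (1+N)) := by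
    field_simp
  rw [e, abs_div, abs_of_pos (by positivity : 0 < 12 * (1+N)), div_le_iff₀ (by positivity)]
  refine htot.trans ?_
  nlinarith

end DSA

/-- **Theorem 1.1.** For a reduced rational `α = v/w ∈ (0,1/2]`, the average of Dedekind sums
over the Farey fractions of order `Q` lying in `[0,α)` is `(1/12)(1 - 1/w²) log Q + O_α(1)`. -/
theorem dedekind_sum_average_rational_cut (α : ℚ) (hα0 : 0 < α) (hα1 : α ≤ 1/2) :
    ∃ C : ℝ, 0 < C ∧ ∀ Q : ℕ, 2 ≤ Q →
      |(1 / ((farey Q).card : ℝ)) * (∑ x ∈ (farey Q).filter (fun x => x < α), sQ x)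
        - 1/12 * (1 - 1/(α.den : ℝ)^2) * Real.log Q| ≤ C := by
  exact DSA.final α hα0 hα1
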